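/- Assume Hypothesis (B): every involution on A₁ is conjugate to α. Let f be an endomorphism of A₁ with P = f(X), Q = f(Y) and image T = f(A₁). If there exists an involution E on A₁ such that E(P) ∈ T and E(Q) ∈ T (so that E restricted to T is an involution on T), then f is an automorphism of A₁. -/

import Mathlib

noncomputable section

/-- `f : A → A` is a `K`-algebra endomorphism (as a bare function). -/
def IsAlgEndo (K : Type) [CommSemiring K] {A : Type} [Semiring A] [Algebra K A]
    (f : A → A) : Prop :=
  (∀ a b : A, f (a + b) = f a + f b) ∧
  (∀ (c : K) (a : A), f (c • a) = c • f a) ∧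
  (∀ a b : A, f (a * b) = f a * f b) ∧ f 1 = 1

/-- `f : A → A` is a `K`-algebra automorphism: a bijective endomorphism. -/
def IsAlgAuto (K : Type) [CommSemiring K] {A : Type} [Semiring A] [Algebra K A]
    (f : A → A) : Prop :=
  IsAlgEndo K f ∧ Function.Bijective f

/-- `f : A → A` is a `K`-linear anti-endomorphism. -/
def IsAntiEndo (K : Type) [CommSemiring K] {A : Type} [Semiring A] [Algebra K A]
    (f : A → A) : Prop :=
  (∀ a b : A, f (a + b) = f a + f b) ∧
  (∀ (c : K) (a : A), f (c • a) = c • f a) ∧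
  (∀ a b : A, f (a * b) = f b * f a) ∧ f 1 = 1

/-- `f : A → A` is an anti-automorphism: a bijective anti-endomorphism. -/
def IsAntiAuto (K : Type) [CommSemiring K] {A : Type} [Semiring A] [Algebra K A]
    (f : A → A) : Prop :=
  IsAntiEndo K f ∧ Function.Bijective f

/-- An involution on a `K`-algebra: an anti-automorphism of order at most two. -/
def IsInvolutionOn (K : Type) [CommSemiring K] {A : Type} [Semiring A] [Algebra K A]
    (γ : A → A) : Prop :=
  IsAntiAuto K γ ∧ γ ∘ γ = id

/-- The defining relation of the first Weyl algebra: `Y*X = X*Y + 1`. -/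
inductive WeylRel (K : Type) [CommSemiring K] :
    FreeAlgebra K (Fin 2) → FreeAlgebra K (Fin 2) → Prop
  | rel : WeylRel K (FreeAlgebra.ι K 1 * FreeAlgebra.ι K 0)
      (FreeAlgebra.ι K 0 * FreeAlgebra.ι K 1 + 1)

/-- The first Weyl algebra `A₁(K) = K⟨X,Y⟩/(YX - XY - 1)`. -/
abbrev Weyl (K : Type) [CommSemiring K] : Type := RingQuot (WeylRel K)

/-- The generator `X` of the Weyl algebra. -/
def Wx (K : Type) [CommSemiring K] : Weyl K :=
  RingQuot.mkAlgHom K (WeylRel K) (FreeAlgebra.ι K 0)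

/-- The generator `Y` of the Weyl algebra. -/
def Wy (K : Type) [CommSemiring K] : Weyl K :=
  RingQuot.mkAlgHom K (WeylRel K) (FreeAlgebra.ι K 1)

/-- `α` is the exchange involution: the involution with `α X = Y` and `α Y = X`. -/
def IsExchange (K : Type) [CommSemiring K] (α : Weyl K → Weyl K) : Prop :=
  IsInvolutionOn K α ∧ α (Wx K) = Wy K ∧ α (Wy K) = Wx K

/-- `γ` is conjugate to `α` by an automorphism or an anti-automorphism:
`γ = g⁻¹ ∘ α ∘ g`. -/
def ConjToAlpha (K : Type) [CommSemiring K] (α γ : Weyl K → Weyl K) : Prop :=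
  ∃ g : Weyl K → Weyl K, (IsAlgAuto K g ∨ IsAntiAuto K g) ∧
    γ = Function.invFun g ∘ α ∘ g


open MvPolynomial

theorem Wrel (S : Type) [CommRing S] : Wy S * Wx S = Wx S * Wy S + 1 := by
  have := RingQuot.mkAlgHom_rel S (WeylRel.rel (K := S))
  simpa [Wx, Wy] using this

def wLift {S A : Type} [CommRing S] [Ring A] [Algebra S A] (P Q : A) (h : Q * P = P * Q + 1) :
    Weyl S →ₐ[S] A :=
  RingQuot.liftAlgHom S ⟨FreeAlgebra.lift S ![P, Q], by
    intro a b hab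
    cases hab
    simp [h]⟩

theorem wLift_x {S A : Type} [CommRing S] [Ring A] [Algebra S A] (P Q : A) (h : Q * P = P * Q + 1) :
    wLift (S := S) P Q h (Wx S) = P := by
  simp [wLift, Wx]

theorem wLift_y {S A : Type} [CommRing S] [Ring A] [Algebra S A] (P Q : A) (h : Q * P = P * Q + 1) :
    wLift (S := S) P Q h (Wy S) = Q := by
  simp [wLift, Wy]

theorem W_induction {S : Type} [CommRing S] {C : Weyl S → Prop} 
    (h1 : C 1) (hs : ∀ (s : S) a, C a → C (s • a))
    (hx : ∀ a, C a → C (Wx S * a)) (hy : ∀ a, C a → C (Wy S * a))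
    (ha : ∀ a b, C a → C b → C (a + b)) (a : Weyl S) : C a := by
  suffices h : ∀ (z : FreeAlgebra S (Fin 2)) (a : Weyl S), C a → C (RingQuot.mkAlgHom S (WeylRel S) z * a) by
    obtain ⟨z, rfl⟩ := RingQuot.mkAlgHom_surjective S (WeylRel S) a
    have := h z 1 h1
    simpa using this
  intro z
  induction z using FreeAlgebra.induction with
  | grade0 r =>
    intro a hC
    have := hs r a hC
    rw [Algebra.smul_def] at this
    simpa using this
  | grade1 i =>
    intro a hC
    fin_cases i
    · exact hx a hC
    · exact hy a hC
  | mul z w hz hw =>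
    intro a hC
    rw [map_mul, mul_assoc]
    exact hz _ (hw _ hC)
  | add z w hz hw =>
    intro a hC
    rw [map_add, add_mul]
    exact ha _ _ (hz _ hC) (hw _ hC)

/-- left action on normal ordered symbols -/
def wAct (S : Type) [CommRing S] : Weyl S →ₐ[S] Module.End S (MvPolynomial (Fin 2) S) :=
  wLift (LinearMap.mulLeft S (X 0)) (LinearMap.mulLeft S (X 1) + (pderiv 0).toLinearMap) (by
    apply LinearMap.ext
    intro g
    simp only [Module.End.mul_apply, LinearMap.add_apply, LinearMap.mulLeft_apply,
      Derivation.coeFn_coe, Derivation.leibniz, pderiv_X_self, smul_eq_mul, Module.End.one_apply]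
    ring)

theorem wAct_x {S : Type} [CommRing S] (g : MvPolynomial (Fin 2) S) :
    wAct S (Wx S) g = X 0 * g := by
  simp [wAct, wLift_x]

theorem wAct_y {S : Type} [CommRing S] (g : MvPolynomial (Fin 2) S) :
    wAct S (Wy S) g = X 1 * g + pderiv 0 g := by
  simp [wAct, wLift_y]

def sym {S : Type} [CommRing S] : Weyl S →ₗ[S] MvPolynomial (Fin 2) S :=
  (LinearMap.applyₗ (1 : MvPolynomial (Fin 2) S)).comp (wAct S).toLinearMap

theorem sym_def {S : Type} [CommRing S] (a : Weyl S) : sym a = wAct S a 1 := rfl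

theorem sym_mul {S : Type} [CommRing S] (a b : Weyl S) : sym (a * b) = wAct S a (sym b) := by
  simp [sym_def]

theorem sym_one {S : Type} [CommRing S] : sym (1 : Weyl S) = 1 := by
  simp [sym_def]

/-- normal ordering -/
def nord {S : Type} [CommRing S] : MvPolynomial (Fin 2) S →ₗ[S] Weyl S :=
  (MvPolynomial.basisMonomials (Fin 2) S).constr S (fun e => Wx S ^ e 0 * Wy S ^ e 1)

theorem nord_monomial {S : Type} [CommRing S] (e : Fin 2 →₀ ℕ) (c : S) :
    nord (monomial e c) = c • (Wx S ^ e 0 * Wy S ^ e 1) := by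
  have : monomial e c = c • (MvPolynomial.basisMonomials (Fin 2) S) e := by
    simp [MvPolynomial.smul_monomial]
  rw [this, map_smul, nord, Module.Basis.constr_basis]

theorem nord_one {S : Type} [CommRing S] : nord (1 : MvPolynomial (Fin 2) S) = 1 := by
  have := nord_monomial (S := S) 0 1
  simpa using this

theorem y_xpow {S A : Type} [CommRing S] [Ring A] [Algebra S A] {x y : A} (h : y * x = x * y + 1) (n : ℕ) :
    y * x ^ n = x ^ n * y + n • x ^ (n - 1) := by
  induction n with
  | zero => simp
  | succ n ih =>
    rw [pow_succ, ← mul_assoc, ih, add_mul, mul_assoc, h]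
    rcases n with _ | n
    · simp
    · simp only [Nat.add_sub_cancel, add_mul, smul_mul_assoc, ← pow_succ, add_smul, mul_add, ← mul_assoc, mul_one, one_smul]
      abel

theorem ypow_x {S A : Type} [CommRing S] [Ring A] [Algebra S A] {x y : A} (h : y * x = x * y + 1) (n : ℕ) :
    y ^ n * x = x * y ^ n + n • y ^ (n - 1) := by
  induction n with
  | zero => simp
  | succ n ih =>
    rw [pow_succ', mul_assoc, ih, mul_add, ← mul_assoc, h]
    rcases n with _ | n
    · simp
    · simp only [Nat.add_sub_cancel, mul_add, mul_smul_comm, ← pow_succ', add_smul, add_mul, mul_assoc, one_mul, one_smul]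
      abel

theorem x_mul_nord {S : Type} [CommRing S] (g : MvPolynomial (Fin 2) S) :
    Wx S * nord g = nord (X 0 * g) := by
  induction g using MvPolynomial.induction_on' with
  | monomial e c =>
    rw [X, monomial_mul, nord_monomial, nord_monomial]
    simp [pow_add, mul_assoc]
  | add p q hp hq => rw [map_add, mul_add, hp, hq, mul_add, map_add]

theorem nord_mul_y {S : Type} [CommRing S] (g : MvPolynomial (Fin 2) S) :
    nord g * Wy S = nord (g * X 1) := by
  induction g using MvPolynomial.induction_on' with
  | monomial e c =>
    rw [X, monomial_mul, nord_monomial, nord_monomial]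
    simp [pow_add, mul_assoc]
  | add p q hp hq => rw [map_add, add_mul, hp, hq, add_mul, map_add]

theorem y_mul_nord {S : Type} [CommRing S] (g : MvPolynomial (Fin 2) S) :
    Wy S * nord g = nord g * Wy S + nord (pderiv 0 g) := by
  induction g using MvPolynomial.induction_on' with
  | monomial e c =>
    rw [pderiv_monomial, nord_monomial, nord_monomial, mul_smul_comm, ← mul_assoc,
      y_xpow (S := S) (Wrel S), add_mul, mul_assoc]
    simp only [smul_add, smul_mul_assoc, mul_assoc, ← pow_succ', ← pow_succ, Finsupp.tsub_apply,
      Finsupp.single_eq_same]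
    congr 1
    rw [← Nat.cast_smul_eq_nsmul S, smul_smul]
    simp
  | add p q hp hq => simp only [map_add, mul_add, hp, hq, add_mul]; abel

theorem nord_mul_x {S : Type} [CommRing S] (g : MvPolynomial (Fin 2) S) :
    nord g * Wx S = Wx S * nord g + nord (pderiv 1 g) := by
  induction g using MvPolynomial.induction_on' with
  | monomial e c =>
    rw [pderiv_monomial, nord_monomial, nord_monomial, mul_smul_comm, smul_mul_assoc, mul_assoc,
      ypow_x (S := S) (Wrel S), mul_add]
    simp only [smul_add, mul_smul_comm, ← mul_assoc, ← pow_succ', ← pow_succ, Finsupp.tsub_apply,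
      Finsupp.single_eq_same]
    congr 1
    rw [← Nat.cast_smul_eq_nsmul S, smul_smul]
    simp
  | add p q hp hq => simp only [map_add, mul_add, hp, hq, add_mul]; abel

theorem mul_nord {S : Type} [CommRing S] (a : Weyl S) (g : MvPolynomial (Fin 2) S) :
    a * nord g = nord (wAct S a g) := by
  revert g
  induction a using W_induction with
  | h1 => intro g; simp
  | hs s a h => intro g; simp [h]
  | hx a h => intro g; rw [mul_assoc, h, x_mul_nord, map_mul (wAct S), Module.End.mul_apply, wAct_x]
  | hy a h =>
    intro g
    rw [mul_assoc, h, y_mul_nord, nord_mul_y, map_mul (wAct S), Module.End.mul_apply, wAct_y, ← map_add, mul_comm (X 1)]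
  | ha a b h h' => intro g; simp [add_mul, h, h']

theorem nord_sym {S : Type} [CommRing S] (a : Weyl S) : nord (sym a) = a := by
  rw [sym_def, ← mul_nord, nord_one, mul_one]

theorem sym_ypow {S : Type} [CommRing S] (n : ℕ) : sym (Wy S ^ n) = X 1 ^ n := by
  induction n with
  | zero => simp [sym_one]
  | succ n ih =>
    rw [pow_succ', sym_mul, ih, wAct_y]
    simp [pderiv_X, pow_succ']

theorem sym_nord {S : Type} [CommRing S] (g : MvPolynomial (Fin 2) S) : sym (nord g) = g := by
  induction g using MvPolynomial.induction_on' with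
  | monomial e c =>
    rw [nord_monomial, map_smul, sym_mul, sym_ypow]
    have : ∀ (n : ℕ) (g : MvPolynomial (Fin 2) S), wAct S (Wx S ^ n) g = X 0 ^ n * g := by
      intro n g
      induction n with
      | zero => simp
      | succ n ih => rw [pow_succ', map_mul, Module.End.mul_apply, ih, wAct_x, pow_succ', mul_assoc]
    rw [this, monomial_eq, smul_eq_C_mul, Finsupp.prod_fintype]
    · simp [Fin.prod_univ_two]
    · simp
  | add p q hp hq => simp [hp, hq]

theorem sym_inj {S : Type} [CommRing S] {a b : Weyl S} (h : sym a = sym b) : a = b := by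
  rw [← nord_sym a, h, nord_sym]

theorem nord_inj {S : Type} [CommRing S] {a b : MvPolynomial (Fin 2) S} (h : nord a = nord b) : a = b := by
  rw [← sym_nord a, h, sym_nord]

/-- base change -/
def mapW {S S' : Type} [CommRing S] [CommRing S'] (σ : S →+* S') : Weyl S →+* Weyl S' :=
  letI := σ.toAlgebra
  (wLift (S := S) (A := Weyl S') (Wx S') (Wy S') (Wrel S')).toRingHom

theorem mapW_x {S S' : Type} [CommRing S] [CommRing S'] (σ : S →+* S') : mapW σ (Wx S) = Wx S' := by
  letI := σ.toAlgebra
  exact wLift_x (S := S) (A := Weyl S') _ _ _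

theorem mapW_y {S S' : Type} [CommRing S] [CommRing S'] (σ : S →+* S') : mapW σ (Wy S) = Wy S' := by
  letI := σ.toAlgebra
  exact wLift_y (S := S) (A := Weyl S') _ _ _

theorem mapW_smul {S S' : Type} [CommRing S] [CommRing S'] (σ : S →+* S') (s : S) (a : Weyl S) :
    mapW σ (s • a) = σ s • mapW σ a := by
  letI := σ.toAlgebra
  have := map_smul (wLift (S := S) (A := Weyl S') (Wx S') (Wy S') (Wrel S')) s a
  refine this.trans ?_
  rw [← algebraMap_smul S' s]
  rfl

theorem mapW_nord {S S' : Type} [CommRing S] [CommRing S'] (σ : S →+* S') (g : MvPolynomial (Fin 2) S) :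
    mapW σ (nord g) = nord (MvPolynomial.map σ g) := by
  induction g using MvPolynomial.induction_on' with
  | monomial e c =>
    rw [nord_monomial, mapW_smul, map_monomial, nord_monomial, map_mul, map_pow, map_pow, mapW_x, mapW_y]
  | add p q hp hq => simp [hp, hq]

theorem sym_mapW {S S' : Type} [CommRing S] [CommRing S'] (σ : S →+* S') (a : Weyl S) :
    sym (mapW σ a) = MvPolynomial.map σ (sym a) := by
  apply nord_inj
  rw [nord_sym, ← mapW_nord, nord_sym]

/-- the involution `x ↦ x`, `y ↦ -y` -/
def betaH (S : Type) [CommRing S] : Weyl S →ₐ[S] (Weyl S)ᵐᵒᵖ :=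
  wLift (MulOpposite.op (Wx S)) (MulOpposite.op (- Wy S)) (by
    rw [← MulOpposite.op_mul, ← MulOpposite.op_mul, ← MulOpposite.op_one, ← MulOpposite.op_add]
    congr 1
    have h1 := mul_neg (Wx S) (Wy S)
    have h2 := neg_mul (Wy S) (Wx S)
    have h3 := Wrel S
    refine h1.trans ?_
    refine Eq.trans ?_ (congrArg (fun t => t + 1) h2.symm)
    simp only [h3]
    abel)

def beta {S : Type} [CommRing S] (a : Weyl S) : Weyl S := MulOpposite.unop (betaH S a)

theorem beta_add {S : Type} [CommRing S] (a b : Weyl S) : beta (a + b) = beta a + beta b := by simp [beta]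
theorem beta_smul {S : Type} [CommRing S] (s : S) (b : Weyl S) : beta (s • b) = s • beta b := by simp [beta]
theorem beta_mul {S : Type} [CommRing S] (a b : Weyl S) : beta (a * b) = beta b * beta a := by simp [beta]
theorem beta_one {S : Type} [CommRing S] : beta (1 : Weyl S) = 1 := by simp [beta]
theorem beta_x {S : Type} [CommRing S] : beta (Wx S) = Wx S := by simp [beta, betaH, wLift_x]
theorem beta_y {S : Type} [CommRing S] : beta (Wy S) = - Wy S := by simp [beta, betaH, wLift_y]
theorem beta_neg {S : Type} [CommRing S] (a : Weyl S) : beta (-a) = - beta a := by simp [beta]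
theorem beta_pow {S : Type} [CommRing S] (a : Weyl S) (n : ℕ) : beta (a ^ n) = beta a ^ n := by simp [beta]
theorem beta_beta {S : Type} [CommRing S] (a : Weyl S) : beta (beta a) = a := by
  induction a using W_induction with
  | h1 => simp [beta_one]
  | hs s a h => simp [beta_smul, h]
  | hx a h => simp [beta_mul, h, beta_x]
  | hy a h => simp [beta_mul, h, beta_y, beta_neg]
  | ha a b h h' => simp [beta_add, h, h']

theorem mapW_beta {S S' : Type} [CommRing S] [CommRing S'] (σ : S →+* S') (a : Weyl S) :
    mapW σ (beta a) = beta (mapW σ a) := by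
  induction a using W_induction with
  | h1 => simp [beta_one]
  | hs s a h => simp [beta_smul, h, mapW_smul]
  | hx a h => simp [beta_mul, h, beta_x, mapW_x]
  | hy a h => simp [beta_mul, h, beta_y, mapW_y]
  | ha a b h h' => simp [beta_add, h, h']


theorem degTwo (e : Fin 2 →₀ ℕ) : e.degree = e 0 + e 1 := by
  rw [Finsupp.degree_eq_sum]; simp [Fin.sum_univ_two]

theorem tdeg_le_iff {S : Type} [CommRing S] (g : MvPolynomial (Fin 2) S) (n : ℕ) :
    g.totalDegree ≤ n ↔ ∀ e, coeff e g ≠ 0 → e 0 + e 1 ≤ n := by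
  constructor
  · intro h e he
    have := le_totalDegree (mem_support_iff.2 he)
    rw [Finsupp.sum_fintype _ _ (by simp)] at this
    simp [Fin.sum_univ_two] at this
    omega
  · intro h
    rw [totalDegree, Finset.sup_le_iff]
    intro e he
    rw [Finsupp.sum_fintype _ _ (by simp)]
    simpa [Fin.sum_univ_two] using h e (mem_support_iff.1 he)

theorem exists_top {S : Type} [CommRing S] (g : MvPolynomial (Fin 2) S) (hg : g ≠ 0) :
    ∃ e, coeff e g ≠ 0 ∧ e 0 + e 1 = g.totalDegree := by
  by_contra! h
  have h1 : ∀ e, coeff e g ≠ 0 → e 0 + e 1 ≤ g.totalDegree := (tdeg_le_iff g _).1 le_rfl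
  obtain ⟨e, he⟩ := exists_coeff_ne_zero hg
  have h2 : 0 < g.totalDegree := by
    have := h1 e he; have := h e he; omega
  have : g.totalDegree ≤ g.totalDegree - 1 := (tdeg_le_iff g _).2 (fun e he => by
    have := h1 e he; have := h e he; omega)
  omega

def Lt (S : Type) [CommRing S] (k : ℕ) : Submodule S (MvPolynomial (Fin 2) S) where
  carrier := {g | ∀ e, k ≤ e 0 + e 1 → coeff e g = 0}
  zero_mem' := by simp
  add_mem' := by
    intro a b ha hb e he
    simp [ha e he, hb e he]
  smul_mem' := by
    intro c a ha e he
    simp [ha e he]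

theorem Lt_def {S : Type} [CommRing S] {k : ℕ} {g : MvPolynomial (Fin 2) S} :
    g ∈ Lt S k ↔ ∀ e, k ≤ e 0 + e 1 → coeff e g = 0 := Iff.rfl

theorem Lt_mono {S : Type} [CommRing S] {k l : ℕ} (h : k ≤ l) {g : MvPolynomial (Fin 2) S}
    (hg : g ∈ Lt S k) : g ∈ Lt S l := fun e he => hg e (h.trans he)

theorem Lt_X {S : Type} [CommRing S] {k : ℕ} {g : MvPolynomial (Fin 2) S}
    (hg : g ∈ Lt S k) (i : Fin 2) : X i * g ∈ Lt S (k + 1) := by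
  intro e he
  rw [coeff_X_mul']
  split_ifs with h
  · apply hg
    fin_cases i
    · simp at h ⊢; omega
    · simp at h ⊢; omega
  · rfl

theorem Lt_pderiv {S : Type} [CommRing S] {k : ℕ} {g : MvPolynomial (Fin 2) S}
    (hg : g ∈ Lt S k) (i : Fin 2) : pderiv i g ∈ Lt S k := by
  intro e he
  rw [coeff_pderiv, hg, zero_mul]
  fin_cases i
  · simp; omega
  · simp; omega

theorem Lt_Xpow {S : Type} [CommRing S] {k : ℕ} {g : MvPolynomial (Fin 2) S}
    (hg : g ∈ Lt S k) (i : Fin 2) (n : ℕ) : X i ^ n * g ∈ Lt S (k + n) := by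
  induction n with
  | zero => simpa using hg
  | succ n ih => rw [pow_succ', mul_assoc]; exact Lt_X ih i

theorem wAct_xpow {S : Type} [CommRing S] (n : ℕ) (g : MvPolynomial (Fin 2) S) :
    wAct S (Wx S ^ n) g = X 0 ^ n * g := by
  induction n with
  | zero => simp
  | succ n ih => rw [pow_succ', map_mul, Module.End.mul_apply, ih, wAct_x, pow_succ', mul_assoc]

theorem wAct_ypow {S : Type} [CommRing S] (j n : ℕ) (g : MvPolynomial (Fin 2) S) (hg : g ∈ Lt S (n + 1)) :
    wAct S (Wy S ^ j) g - X 1 ^ j * g ∈ Lt S (j + n) := by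
  induction j with
  | zero => simp
  | succ j ih =>
    set r := wAct S (Wy S ^ j) g - X 1 ^ j * g with hr
    have h1 : wAct S (Wy S ^ j) g = X 1 ^ j * g + r := by rw [hr]; ring
    have h2 : wAct S (Wy S ^ (j + 1)) g - X 1 ^ (j + 1) * g =
        pderiv 0 (X 1 ^ j * g) + X 1 * r + pderiv 0 r := by
      rw [pow_succ', map_mul, Module.End.mul_apply, wAct_y, h1, map_add]; ring
    rw [h2]
    refine Submodule.add_mem _ (Submodule.add_mem _ ?_ ?_) ?_
    · exact Lt_mono (by omega) (Lt_pderiv (Lt_Xpow hg 1 j) 0)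
    · exact Lt_mono (by omega) (Lt_X ih 1)
    · exact Lt_mono (by omega) (Lt_pderiv ih 0)

theorem wAct_top {S : Type} [CommRing S] (m n : ℕ) (a : Weyl S) (ha : sym a ∈ Lt S (m + 1))
    (g : MvPolynomial (Fin 2) S) (hg : g ∈ Lt S (n + 1)) :
    wAct S a g - sym a * g ∈ Lt S (m + n) := by
  have key : ∀ s : MvPolynomial (Fin 2) S, s ∈ Lt S (m + 1) → wAct S (nord s) g - s * g ∈ Lt S (m + n) := by
    intro s hs
    have h1 : wAct S (nord s) g - s * g = ∑ e ∈ s.support,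
        (wAct S (nord (monomial e (coeff e s))) g - monomial e (coeff e s) * g) := by
      conv_lhs => rw [← support_sum_monomial_coeff s]
      rw [map_sum, map_sum, Finset.sum_mul, LinearMap.sum_apply, Finset.sum_sub_distrib]
    rw [h1]
    apply Submodule.sum_mem
    intro e he
    have he' : e 0 + e 1 ≤ m := by
      by_contra hc
      exact mem_support_iff.1 he (hs e (by omega))
    have h2 : monomial e (coeff e s) = coeff e s • (X 0 ^ e 0 * X 1 ^ e 1) := by
      rw [monomial_eq, smul_eq_C_mul, Finsupp.prod_fintype]
      · simp [Fin.prod_univ_two]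
      · simp
    rw [nord_monomial, h2, map_smul, LinearMap.smul_apply, smul_mul_assoc, ← smul_sub]
    apply Submodule.smul_mem
    rw [map_mul, Module.End.mul_apply, wAct_xpow, mul_assoc, ← mul_sub]
    exact Lt_mono (by omega) (Lt_Xpow (wAct_ypow (e 1) n g hg) 0 (e 0))
  have := key (sym a) ha
  rwa [nord_sym] at this

theorem mem_Lt_tdeg {S : Type} [CommRing S] (g : MvPolynomial (Fin 2) S) :
    g ∈ Lt S (g.totalDegree + 1) := by
  intro e he
  by_contra h
  have := (tdeg_le_iff g _).1 le_rfl e h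
  omega

theorem sym_mul_top {S : Type} [CommRing S] [IsDomain S] (a b : Weyl S) (ha : a ≠ 0) (hb : b ≠ 0) :
    a * b ≠ 0 ∧ (sym (a * b)).totalDegree = (sym a).totalDegree + (sym b).totalDegree := by
  have ha' : sym a ≠ 0 := fun h => ha (sym_inj (by rw [h, map_zero]))
  have hb' : sym b ≠ 0 := fun h => hb (sym_inj (by rw [h, map_zero]))
  have h1 := wAct_top _ _ a (mem_Lt_tdeg _) (sym b) (mem_Lt_tdeg _)
  have h2 : (sym a * sym b).totalDegree = (sym a).totalDegree + (sym b).totalDegree :=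
    totalDegree_mul_of_isDomain ha' hb'
  obtain ⟨e, he, he'⟩ := exists_top _ (mul_ne_zero ha' hb')
  have h3 : coeff e (sym (a * b)) ≠ 0 := by
    have := h1 e (by omega)
    rw [coeff_sub, sub_eq_zero, ← sym_mul] at this
    rw [this]; exact he
  refine ⟨fun h => ?_, le_antisymm ?_ ?_⟩
  · rw [h] at h3; simp at h3
  · rw [tdeg_le_iff]
    intro d hd
    by_contra hc
    have h4 := h1 d (by omega)
    rw [coeff_sub, ← sym_mul, sub_eq_zero] at h4
    have := (tdeg_le_iff (sym a * sym b) _).1 le_rfl d (by rw [← h4]; exact hd)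
    omega
  · have := (tdeg_le_iff (sym (a * b)) _).1 le_rfl e h3
    omega

theorem weyl_nzd {S : Type} [CommRing S] [IsDomain S] {a b : Weyl S} (h : a * b = 0) : a = 0 ∨ b = 0 := by
  by_contra! hc
  exact (sym_mul_top a b hc.1 hc.2).1 h

theorem weyl_one_ne {S : Type} [CommRing S] [Nontrivial S] : (1 : Weyl S) ≠ 0 := by
  intro h
  have := congrArg sym h
  rw [sym_one, map_zero] at this
  exact one_ne_zero this

theorem sym_pow_deg {S : Type} [CommRing S] [IsDomain S] (a : Weyl S) (ha : a ≠ 0) (n : ℕ) :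
    a ^ n ≠ 0 ∧ (sym (a ^ n)).totalDegree = n * (sym a).totalDegree := by
  induction n with
  | zero => simpa [sym_one] using weyl_one_ne
  | succ n ih =>
    have := sym_mul_top (a ^ n) a ih.1 ha
    rw [pow_succ]
    refine ⟨this.1, ?_⟩
    rw [this.2, ih.2]; ring

theorem comm_x {S : Type} [CommRing S] (a : Weyl S) : sym (a * Wx S - Wx S * a) = pderiv 1 (sym a) := by
  apply nord_inj
  rw [nord_sym]
  have := nord_mul_x (sym a)
  rw [nord_sym] at this
  rw [this]; abel

theorem comm_y {S : Type} [CommRing S] (a : Weyl S) : sym (Wy S * a - a * Wy S) = pderiv 0 (sym a) := by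
  apply nord_inj
  rw [nord_sym]
  have := y_mul_nord (sym a)
  rw [nord_sym] at this
  rw [this]; abel


theorem coeff_euler {S : Type} [CommRing S] (g : MvPolynomial (Fin 2) S) (i : Fin 2) (e : Fin 2 →₀ ℕ) :
    coeff e (X i * pderiv i g) = (e i : S) * coeff e g := by
  rw [coeff_X_mul']
  split_ifs with h
  · rw [coeff_pderiv]
    have h1 : e i ≠ 0 := by simpa using h
    have h2 : e - Finsupp.single i 1 + Finsupp.single i 1 = e := by
      ext k
      by_cases hk : i = k
      · subst hk; simp; omega
      · simp [Finsupp.single_apply, hk]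
    rw [h2, mul_comm]
    congr 1
    simp only [Finsupp.tsub_apply, Finsupp.single_eq_same]
    rw [← Nat.cast_add_one, Nat.sub_add_cancel (by omega)]
  · have h1 : e i = 0 := by simpa using h
    simp [h1]

theorem bracket_coeff {S : Type} [CommRing S] (φ ψ : MvPolynomial (Fin 2) S)
    (h : pderiv 0 φ * pderiv 1 ψ - pderiv 1 φ * pderiv 0 ψ = 1) (g : Fin 2 →₀ ℕ) :
    ∑ x ∈ Finset.HasAntidiagonal.antidiagonal g, ((x.1 0 : S) * (x.2 1 : S) - (x.1 1 : S) * (x.2 0 : S)) *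
      (coeff x.1 φ * coeff x.2 ψ) = if g 0 = 1 ∧ g 1 = 1 then 1 else 0 := by
  have h1 : (X 0 * pderiv 0 φ) * (X 1 * pderiv 1 ψ) - (X 1 * pderiv 1 φ) * (X 0 * pderiv 0 ψ) =
      monomial (Finsupp.single 0 1 + Finsupp.single 1 1) (1 : S) := by
    have : monomial (Finsupp.single 0 1 + Finsupp.single 1 1) (1 : S) = X (0 : Fin 2) * X 1 := by
      simp [X, monomial_mul]
    rw [this]
    linear_combination X 0 * X 1 * h
  have h2 := congrArg (coeff g) h1
  rw [coeff_sub, coeff_mul, coeff_mul, ← Finset.sum_sub_distrib, coeff_monomial] at h2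
  simp only [coeff_euler] at h2
  convert h2 using 1
  · apply Finset.sum_congr rfl
    intro x _
    ring
  · congr 1
    rw [eq_iff_iff]
    constructor
    · intro hg
      ext k
      fin_cases k
      · simp [hg.1]
      · simp [hg.2]
    · rintro rfl
      simp

theorem lead_lemma {S Γ : Type} [CommRing S] [IsDomain S] [AddCommGroup Γ] [LinearOrder Γ]
    [IsOrderedAddMonoid Γ]
    (p : ℕ) [CharP S p] (D : ℕ) (hD : D * D < p)
    (φ ψ : MvPolynomial (Fin 2) S)
    (h : pderiv 0 φ * pderiv 1 ψ - pderiv 1 φ * pderiv 0 ψ = 1)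
    (hev : ∀ e, coeff e φ ≠ 0 → Even (e 1)) (hod : ∀ e, coeff e ψ ≠ 0 → Odd (e 1))
    (hφ : ∀ e, coeff e φ ≠ 0 → e 0 + e 1 ≤ D) (hψ : ∀ e, coeff e ψ ≠ 0 → e 0 + e 1 ≤ D)
    (w : (Fin 2 →₀ ℕ) → Γ) (hw : ∀ e f, w (e + f) = w e + w f) (hi : Function.Injective w)
    (e₀ f₀ : Fin 2 →₀ ℕ) (he₀ : coeff e₀ φ ≠ 0) (he₀' : e₀ ≠ 0) (hf₀ : coeff f₀ ψ ≠ 0) :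
    ∃ e f, coeff e φ ≠ 0 ∧ e ≠ 0 ∧ coeff f ψ ≠ 0 ∧
      (∀ e', coeff e' φ ≠ 0 → e' ≠ 0 → w e' ≤ w e) ∧ (∀ f', coeff f' ψ ≠ 0 → w f' ≤ w f) ∧
      ((e 0 = 1 ∧ e 1 = 0 ∧ f 0 = 0 ∧ f 1 = 1) ∨ e 0 * f 1 = e 1 * f 0) := by
  classical
  obtain ⟨e, he, hemax⟩ := Finset.exists_max_image (φ.support.filter (fun e => e ≠ 0)) w
    ⟨e₀, by simp [he₀, he₀']⟩
  obtain ⟨f, hf, hfmax⟩ := Finset.exists_max_image ψ.support w ⟨f₀, by simp [hf₀]⟩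
  simp only [Finset.mem_filter, mem_support_iff] at he hemax hf hfmax
  refine ⟨e, f, he.1, he.2, hf, fun e' h1 h2 => hemax e' ⟨h1, h2⟩, hfmax, ?_⟩
  have hs := bracket_coeff φ ψ h (e + f)
  rw [Finset.sum_eq_single (e, f)] at hs
  · by_cases hg : (e + f) 0 = 1 ∧ (e + f) 1 = 1
    · left
      simp only [Finsupp.add_apply] at hg
      have h1 := hev e he.1
      have h2 := hod f hf
      have h3 : e 1 = 0 := by
        rcases Nat.lt_or_ge (e 1) 1 with h | h
        · omega
        · have : e 1 = 1 := by omega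
          rw [this] at h1
          exact absurd h1 (by decide)
      have h4 : e 0 ≠ 0 := by
        intro h4
        apply he.2
        ext k
        fin_cases k
        · simpa using h4
        · simpa using h3
      omega
    · right
      rw [if_neg hg] at hs
      have hne : coeff e φ * coeff f ψ ≠ 0 := mul_ne_zero he.1 hf
      have h0 : ((e 0 : S) * (f 1 : S) - (e 1 : S) * (f 0 : S)) = 0 := by
        rcases mul_eq_zero.1 hs with h | h
        · exact h
        · exact absurd h hne
      have h1 : ((e 0 * f 1 : ℕ) : S) = ((e 1 * f 0 : ℕ) : S) := by
        push_cast
        exact sub_eq_zero.1 h0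
      have a1 := hφ e he.1
      have a2 := hψ f hf
      rw [CharP.cast_eq_iff_mod_eq S p] at h1
      rw [Nat.mod_eq_of_lt, Nat.mod_eq_of_lt] at h1
      · exact h1
      · exact lt_of_le_of_lt (Nat.mul_le_mul (by omega) (by omega)) hD
      · exact lt_of_le_of_lt (Nat.mul_le_mul (by omega) (by omega)) hD
  · rintro ⟨e', f'⟩ hx hne
    rw [Finset.HasAntidiagonal.mem_antidiagonal] at hx
    simp only at hx ⊢
    by_contra hc
    have h1 : coeff e' φ ≠ 0 := by
      intro h; rw [h] at hc; simp at hc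
    have h2 : coeff f' ψ ≠ 0 := by
      intro h; rw [h] at hc; simp at hc
    have h3 : e' ≠ 0 := by
      rintro rfl; simp at hc
    have h4 := hemax e' ⟨h1, h3⟩
    have h5 := hfmax f' h2
    have h6 : w e' + w f' = w e + w f := by rw [← hw, ← hw, hx]
    have h7 : w e' = w e := by
      refine le_antisymm h4 ?_
      by_contra hlt
      have := add_lt_add_of_lt_of_le (not_le.1 hlt) h5
      exact absurd h6 (ne_of_lt this)
    have h8 : w f' = w f := by rw [h7] at h6; exact add_left_cancel h6
    exact hne (by rw [hi h7, hi h8])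
  · intro hx
    rw [Finset.HasAntidiagonal.mem_antidiagonal] at hx
    exact absurd rfl hx

def lexW (A B C E : ℤ) (e : Fin 2 →₀ ℕ) : Lex (ℤ × ℤ) :=
  toLex (A * e 0 + B * e 1, C * e 0 + E * e 1)

theorem lexW_add (A B C E : ℤ) (e f : Fin 2 →₀ ℕ) : lexW A B C E (e + f) = lexW A B C E e + lexW A B C E f := by
  unfold lexW
  rw [← toLex_add]
  congr 1
  simp only [Finsupp.add_apply, Prod.mk_add_mk, Nat.cast_add]
  congr 1 <;> ring

theorem lexW_inj (A B C E : ℤ) (h : A * E - B * C ≠ 0) : Function.Injective (lexW A B C E) := by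
  intro e f hef
  have h1 := congrArg (fun t => (ofLex t).1) hef
  have h2 := congrArg (fun t => (ofLex t).2) hef
  simp only [lexW, ofLex_toLex] at h1 h2
  have h3 : (A * E - B * C) * ((e 0 : ℤ) - f 0) = 0 := by linear_combination E * h1 - B * h2
  have h4 : (A * E - B * C) * ((e 1 : ℤ) - f 1) = 0 := by linear_combination A * h2 - C * h1
  have h5 := (mul_eq_zero.1 h3).resolve_left h
  have h6 := (mul_eq_zero.1 h4).resolve_left h
  ext k
  fin_cases k
  · simp; omega
  · simp; omega

theorem lexW_le (A B C E : ℤ) (e f : Fin 2 →₀ ℕ) : lexW A B C E e ≤ lexW A B C E f ↔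
    A * e 0 + B * e 1 < A * f 0 + B * f 1 ∨ (A * e 0 + B * e 1 = A * f 0 + B * f 1 ∧
      C * e 0 + E * e 1 ≤ C * f 0 + E * f 1) := by
  unfold lexW
  rw [Prod.Lex.toLex_le_toLex]

theorem comm_lemma {S : Type} [CommRing S] [IsDomain S]
    (p : ℕ) [CharP S p] (D : ℕ) (hD : D * D < p)
    (φ ψ : MvPolynomial (Fin 2) S)
    (h : pderiv 0 φ * pderiv 1 ψ - pderiv 1 φ * pderiv 0 ψ = 1)
    (hev : ∀ e, coeff e φ ≠ 0 → Even (e 1)) (hod : ∀ e, coeff e ψ ≠ 0 → Odd (e 1))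
    (hφ : φ.totalDegree ≤ D) (hψ : ψ.totalDegree ≤ D) : ψ.totalDegree ≤ 1 := by
  classical
  rw [tdeg_le_iff] at hφ hψ
  have hpos : ∀ f, coeff f ψ ≠ 0 → 1 ≤ f 1 := fun f hf => (hod f hf).pos
  obtain ⟨u, v, hu, hu0, hu1, hv, hv0, hv1⟩ : ∃ u v : Fin 2 →₀ ℕ, coeff u φ ≠ 0 ∧ u 0 = 1 ∧ u 1 = 0 ∧
      coeff v ψ ≠ 0 ∧ v 0 = 0 ∧ v 1 = 1 := by
    have hs := bracket_coeff φ ψ h (Finsupp.single 0 1 + Finsupp.single 1 1)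
    rw [if_pos (by simp)] at hs
    obtain ⟨⟨e, f⟩, hx, hc⟩ := Finset.exists_ne_zero_of_sum_ne_zero (by rw [hs]; exact one_ne_zero)
    rw [Finset.HasAntidiagonal.mem_antidiagonal] at hx
    simp only at hx hc
    have h1 : coeff e φ ≠ 0 := by
      intro h; rw [h] at hc; simp at hc
    have h2 : coeff f ψ ≠ 0 := by
      intro h; rw [h] at hc; simp at hc
    have h3 := congrArg (fun t => t 0) hx
    have h4 := congrArg (fun t => t 1) hx
    simp at h3 h4
    have h5 := hpos f h2
    have h6 : e 0 ≠ 0 := by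
      intro h6
      have : e 1 = 0 := by omega
      rw [h6, this] at hc; simp at hc
    exact ⟨e, f, h1, by omega, by omega, h2, by omega, by omega⟩
  have hune : u ≠ 0 := by rintro rfl; simp at hu0
  have LL := fun (A B C E : ℤ) (hd : A * E - B * C ≠ 0) =>
    lead_lemma p D hD φ ψ h hev hod hφ hψ (lexW A B C E) (lexW_add A B C E) (lexW_inj A B C E hd)
      u v hu hune hv
  simp only [lexW_le] at LL
  have L1 : ∀ e, coeff e φ ≠ 0 → e 1 = 0 → e 0 ≤ 1 := by
    intro g hg hg1
    by_cases hg0 : g = 0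
    · simp [hg0]
    obtain ⟨e, f, he, he', hf, hm, -, hc⟩ := LL 0 (-1) 1 0 (by norm_num)
    have h1 := hm u hu hune
    have h2 := hm g hg hg0
    have h3 := hpos f hf
    rcases hc with hc | hc
    · omega
    · have h4 : e 1 = 0 := by omega
      rw [h4, zero_mul] at hc
      rcases Nat.mul_eq_zero.1 hc with h | h
      · omega
      · omega
  rw [tdeg_le_iff]
  by_cases hA : ∀ e, coeff e φ ≠ 0 → 1 ≤ e 1 → e 0 = 0
  · obtain ⟨e, f, he, he', hf, hm, hm', hc⟩ := LL 1 0 0 1 (by norm_num)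
    have h1 := hm u hu hune
    have h2 : e 1 = 0 := by
      by_contra hne
      have := hA e he (by omega)
      omega
    have h3 := L1 e he h2
    have h4 := hpos f hf
    intro g hg
    have h5 := hm' g hg
    rcases hc with hc | hc
    · omega
    · have h6 : e 0 = 1 := by omega
      rw [h2, h6] at hc
      omega
  · push Not at hA
    obtain ⟨e₁, h1, h2, h3⟩ := hA
    exfalso
    obtain ⟨m, hm, hmax⟩ := Finset.exists_max_image (φ.support.filter (fun e => 1 ≤ e 1))
      (fun e => ((e 0 : ℚ) - 1) / e 1) ⟨e₁, by simp [h1]; omega⟩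
    simp only [Finset.mem_filter, mem_support_iff] at hm hmax
    obtain ⟨i, hi⟩ : ∃ i : ℤ, i = (m 0 : ℤ) - 1 := ⟨_, rfl⟩
    obtain ⟨j, hj⟩ : ∃ j : ℤ, j = (m 1 : ℤ) := ⟨_, rfl⟩
    have hjpos : 1 ≤ j := by omega
    have hmax' : ∀ e, coeff e φ ≠ 0 → 1 ≤ e 1 → ((e 0 : ℤ) - 1) * j ≤ i * e 1 := by
      intro e he he1
      have := hmax e ⟨he, he1⟩
      have a1 : (0 : ℚ) < e 1 := by exact_mod_cast he1
      have a2 : (0 : ℚ) < m 1 := by exact_mod_cast hm.2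
      rw [div_le_div_iff₀ a1 a2] at this
      rw [hi, hj]
      exact_mod_cast this
    have hipos : 0 ≤ i := by
      have := hmax' e₁ h1 h2
      by_contra hneg
      have b1 : (0 : ℤ) ≤ ((e₁ 0 : ℤ) - 1) * j := mul_nonneg (by omega) (by omega)
      have b2 : i * (e₁ 1 : ℤ) < 0 := mul_neg_of_neg_of_pos (by omega) (by omega)
      omega
    have hval : ∀ e, coeff e φ ≠ 0 → e ≠ 0 → j * e 0 + (-i) * e 1 ≤ j := by
      intro e he hne
      rcases Nat.lt_or_ge (e 1) 1 with hlt | hge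
      · have h4 : e 1 = 0 := by omega
        have h5 := L1 e he h4
        rw [h4]
        have h6 : (e 0 : ℤ) ≤ 1 := by exact_mod_cast h5
        nlinarith
      · have := hmax' e he hge
        nlinarith
    have hmne : m ≠ 0 := by
      rintro rfl
      simp at hm
    -- low tie break
    have hlow : ∀ f, coeff f ψ ≠ 0 → j * f 0 + (-i) * f 1 ≤ -i := by
      obtain ⟨e, f, he, he', hf, hm1, hm2, hc⟩ := LL j (-i) 0 (-1) (by simp; omega)
      have a1 := hm1 u hu hune
      rw [hu0, hu1] at a1
      have a2 := hval e he he'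
      have a3 : e 1 = 0 := by
        push_cast at a1
        rcases a1 with a1 | a1
        · linarith
        · omega
      have a4 := L1 e he a3
      have a5 := hpos f hf
      have a6 : e 0 ≠ 0 := by
        intro a6
        apply he'
        ext k
        fin_cases k
        · simpa using a6
        · simpa using a3
      have a7 : f 0 = 0 ∧ f 1 = 1 := by
        rcases hc with hc | hc
        · omega
        · rw [a3, zero_mul] at hc
          rcases Nat.mul_eq_zero.1 hc with h | h
          · omega
          · omega
      intro g hg
      have a8 := hm2 g hg
      rw [a7.1, a7.2] at a8
      push_cast at a8
      rcases a8 with a8 | a8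
      · linarith
      · linarith
    obtain ⟨e, f, he, he', hf, hm1, hm2, hc⟩ := LL j (-i) 0 1 (by simp; omega)
    have a1 := hm1 m hm.1 hmne
    have a2 := hval e he he'
    have a3 := hm2 v hv
    have a4 := hlow f hf
    rw [hv0, hv1] at a3
    have hm0 : (m 0 : ℤ) = i + 1 := by omega
    rw [hm0, ← hj] at a1
    have a5 : j * (e 0 : ℤ) + (-i) * e 1 = j ∧ 1 ≤ e 1 := by
      rcases a1 with a1 | a1
      · nlinarith
      · refine ⟨by nlinarith, by omega⟩
    have a6 : j * (f 0 : ℤ) + (-i) * f 1 = -i := by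
      push_cast at a3
      rcases a3 with a3 | a3 <;> linarith
    have a7 := hpos f hf
    rcases hc with hc | hc
    · omega
    · have hc' : (e 0 : ℤ) * f 1 = e 1 * f 0 := by exact_mod_cast hc
      have a8 : j * f 1 + i * e 1 = 0 := by
        linear_combination (-(f 1 : ℤ)) * a5.1 + (e 1 : ℤ) * a6 + j * hc'
      have a9 : 0 < j * (f 1 : ℤ) := mul_pos (by omega) (by omega)
      have a10 : 0 ≤ i * (e 1 : ℤ) := mul_nonneg hipos (by omega)
      omega


theorem central_of_comm {S : Type} [CommRing S] (c : Weyl S) (hx : c * Wx S = Wx S * c)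
    (hy : c * Wy S = Wy S * c) (a : Weyl S) : c * a = a * c := by
  induction a using W_induction with
  | h1 => simp
  | hs s a h => simp [h]
  | hx a h => rw [← mul_assoc, hx, mul_assoc, h, mul_assoc]
  | hy a h => rw [← mul_assoc, hy, mul_assoc, h, mul_assoc]
  | ha a b h h' => rw [mul_add, h, h', add_mul]

theorem qpow_t {F A : Type} [CommRing F] [Ring A] [Algebra F A] {q t : A} {s : F}
    (h : q * t = t * q + s • 1) (n : ℕ) :
    q ^ (n + 1) * t = t * q ^ (n + 1) + ((n + 1 : ℕ) * s) • q ^ n := by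
  induction n with
  | zero => simp [h]
  | succ n ih =>
    rw [pow_succ' q (n + 1), mul_assoc, ih, mul_add, ← mul_assoc, h, add_mul, mul_smul_comm,
      smul_mul_assoc, one_mul, ← pow_succ', mul_assoc, ← pow_succ', add_assoc, ← add_smul]
    congr 2
    push_cast
    ring

theorem indep_aux {F A : Type} [Field F] (p : ℕ) [Fact p.Prime] [CharP F p] [Ring A] [Algebra F A] {q t : A} {s : F}
    (hs : s ≠ 0)
    (h : q * t = t * q + s • 1) (n : ℕ) (hn : n ≤ p) (a : Fin n → A) (ha : ∀ j, a j * t = t * a j)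
    (hsum : ∑ j, a j * q ^ (j : ℕ) = 0) : ∀ j, a j = 0 := by
  induction n with
  | zero => intro j; exact j.elim0
  | succ n ih =>
    have h1 : ∑ j : Fin n, (((j : ℕ) + 1 : ℕ) * s : F) • a j.succ * q ^ (j : ℕ) = 0 := by
      have h2 : (∑ j, a j * q ^ (j : ℕ)) * t - t * ∑ j, a j * q ^ (j : ℕ) = 0 := by
        rw [hsum]; simp
      rw [Fin.sum_univ_succ, add_mul, mul_add, Finset.sum_mul, Finset.mul_sum] at h2
      rw [← h2]
      simp only [Fin.val_zero, pow_zero, mul_one, ha, Fin.val_succ]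
      rw [add_sub_add_left_eq_sub, ← Finset.sum_sub_distrib]
      apply Finset.sum_congr rfl
      intro j _
      rw [mul_assoc, qpow_t h, mul_add, ← mul_assoc, ha, ← mul_assoc t, add_sub_cancel_left,
        mul_smul_comm, smul_mul_assoc]
    have h3 := ih (by omega) (fun j => (((j : ℕ) + 1 : ℕ) * s : F) • a j.succ) (by
      intro j; simp [ha]) h1
    have h4 : ∀ j : Fin n, a j.succ = 0 := by
      intro j
      have h5 := h3 j
      have h6 : (((j : ℕ) + 1 : ℕ) : F) ≠ 0 := by
        rw [Ne, CharP.cast_eq_zero_iff F p]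
        intro hd
        have := Nat.le_of_dvd (by omega) hd
        have := j.2
        omega
      exact (smul_eq_zero_iff_right (mul_ne_zero h6 hs)).1 h5
    intro j
    refine Fin.cases ?_ h4 j
    rw [Fin.sum_univ_succ] at hsum
    simpa [h4] using hsum

theorem neg_rel {F A : Type} [CommRing F] [Ring A] [Algebra F A] {P Q : A} (h : Q * P = P * Q + 1) :
    P * Q = Q * P + (-1 : F) • 1 := by rw [h]; simp

section charp
variable {p : ℕ} [Fact p.Prime]

theorem comm_pow_p {S A : Type} [CommRing S] [Ring A] [Algebra S A] [CharP S p] {P Q : A} (h : Q * P = P * Q + 1) :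
    P ^ p * Q = Q * P ^ p ∧ Q ^ p * P = P * Q ^ p := by
  have h0 : ((p : ℕ) : S) = 0 := CharP.cast_eq_zero S p
  obtain ⟨k, hk⟩ : ∃ k, p = k + 1 := ⟨p - 1, by have := (Fact.out : p.Prime).pos; omega⟩
  constructor
  · have h1 : P * Q = Q * P + (-1 : S) • 1 := by rw [h]; simp
    have h2 := qpow_t h1 k
    rw [← hk, h0] at h2
    simpa using h2
  · have h1 : Q * P = P * Q + (1 : S) • 1 := by rw [h]; simp
    have h2 := qpow_t h1 k
    rw [← hk, h0] at h2
    simpa using h2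

theorem xp_central (a : Weyl (ZMod p)) : Wx (ZMod p) ^ p * a = a * Wx (ZMod p) ^ p := by
  apply central_of_comm
  · rw [← pow_succ, ← pow_succ']
  · exact (comm_pow_p (p := p) (S := ZMod p) (Wrel (ZMod p))).1

theorem yp_central (a : Weyl (ZMod p)) : Wy (ZMod p) ^ p * a = a * Wy (ZMod p) ^ p := by
  apply central_of_comm
  · exact (comm_pow_p (p := p) (S := ZMod p) (Wrel (ZMod p))).2
  · rw [← pow_succ, ← pow_succ']

abbrev ZC (p : ℕ) [Fact p.Prime] := Subalgebra.center (ZMod p) (Weyl (ZMod p))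

theorem span_center : Submodule.span (ZC p) (Set.range (fun x : Fin p × Fin p =>
    Wx (ZMod p) ^ (x.1 : ℕ) * Wy (ZMod p) ^ (x.2 : ℕ))) = ⊤ := by
  have hp : 0 < p := (Fact.out : p.Prime).pos
  rw [eq_top_iff]
  intro a _
  rw [← nord_sym a, ← support_sum_monomial_coeff (sym a), map_sum]
  apply Submodule.sum_mem
  intro e _
  rw [nord_monomial]
  let z : ZC p := ⟨Wx (ZMod p) ^ p, Subalgebra.mem_center_iff.2 (fun b => (xp_central b).symm)⟩
  let w : ZC p := ⟨Wy (ZMod p) ^ p, Subalgebra.mem_center_iff.2 (fun b => (yp_central b).symm)⟩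
  have h1 : coeff e (sym a) • (Wx (ZMod p) ^ e 0 * Wy (ZMod p) ^ e 1) =
      (coeff e (sym a) • (z ^ (e 0 / p) * w ^ (e 1 / p)) : ZC p) •
        (Wx (ZMod p) ^ (e 0 % p) * Wy (ZMod p) ^ (e 1 % p)) := by
    rw [Subalgebra.smul_def]
    simp only [Subalgebra.coe_smul, Subalgebra.coe_mul, Subalgebra.coe_pow, z, w, smul_eq_mul]
    rw [smul_mul_assoc]
    congr 1
    conv_lhs => rw [← Nat.div_add_mod (e 0) p, ← Nat.div_add_mod (e 1) p, pow_add, pow_add, pow_mul, pow_mul]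
    have h2 : Commute (Wx (ZMod p) ^ (e 0 % p)) ((Wy (ZMod p) ^ p) ^ (e 1 / p)) :=
      Commute.pow_right (yp_central _).symm _
    simp only [mul_assoc]
    congr 1
    rw [← mul_assoc, h2.eq, mul_assoc]
  rw [h1]
  apply Submodule.smul_mem
  apply Submodule.subset_span
  exact ⟨(⟨e 0 % p, Nat.mod_lt _ hp⟩, ⟨e 1 % p, Nat.mod_lt _ hp⟩), rfl⟩

theorem center_comm (z : ZC p) (a : Weyl (ZMod p)) : (z : Weyl (ZMod p)) * a = a * z :=
  (Subalgebra.mem_center_iff.1 z.2 a).symm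

theorem centralizer_central (P Q c : Weyl (ZMod p)) (h : Q * P = P * Q + 1)
    (hP : c * P = P * c) (hQ : c * Q = Q * c) (a : Weyl (ZMod p)) : c * a = a * c := by
  classical
  by_contra hne
  have hp : 0 < p := (Fact.out : p.Prime).pos
  let v : (Fin p × Fin p) × Fin 2 → Weyl (ZMod p) := fun x => c ^ (x.2 : ℕ) * P ^ (x.1.2 : ℕ) * Q ^ (x.1.1 : ℕ)
  have hv : LinearIndependent (ZC p) v := by
    refine (Fintype.linearIndependent_iff (R := ZC p) (v := v)).2 ?_
    intro g hg
    have b_comm : ∀ (z0 z1 : ZC p) (t : Weyl (ZMod p)), c * t = t * c →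
        ((z0 : Weyl (ZMod p)) + z1 * c) * t = t * (z0 + z1 * c) := by
      intro z0 z1 t ht
      rw [add_mul, mul_add, center_comm, mul_assoc, ht, ← mul_assoc, center_comm z1 t, mul_assoc]
    have hsum : ∑ j : Fin p, (∑ i : Fin p, ((g ((j, i), 0) : Weyl (ZMod p)) + g ((j, i), 1) * c) * P ^ (i : ℕ))
        * Q ^ (j : ℕ) = 0 := by
      rw [← hg, Fintype.sum_prod_type, Fintype.sum_prod_type]
      apply Finset.sum_congr rfl
      intro j _
      rw [Finset.sum_mul]
      apply Finset.sum_congr rfl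
      intro i _
      simp only [Fin.sum_univ_two, v, Subalgebra.smul_def, add_mul, smul_eq_mul]
      simp [mul_assoc]
    have h1 := indep_aux (F := ZMod p) p (q := Q) (t := P) (s := 1) one_ne_zero (by rw [h]; simp) p le_rfl _ (by
      intro j
      rw [Finset.sum_mul, Finset.mul_sum]
      apply Finset.sum_congr rfl
      intro i _
      rw [mul_assoc, ← pow_succ, pow_succ', ← mul_assoc, b_comm _ _ _ hP, mul_assoc]) hsum
    have h2 : ∀ j i, ((g ((j, i), 0) : Weyl (ZMod p)) + g ((j, i), 1) * c) = 0 := by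
      intro j
      exact indep_aux (F := ZMod p) p (q := P) (t := Q) (s := -1) (neg_ne_zero.2 one_ne_zero) (neg_rel h) p le_rfl _
        (by intro i; exact b_comm _ _ _ hQ) (h1 j)
    have h3 : ∀ j i, g ((j, i), 1) = 0 := by
      intro j i
      have h4 : (g ((j, i), 1) : Weyl (ZMod p)) * (c * a - a * c) = 0 := by
        have h5 : (((g ((j, i), 0) : Weyl (ZMod p)) + g ((j, i), 1) * c)) * a -
          a * (((g ((j, i), 0) : Weyl (ZMod p)) + g ((j, i), 1) * c)) = 0 := by rw [h2]; simp
        rw [← h5, add_mul, mul_add, center_comm (g ((j, i), 0)) a, add_sub_add_left_eq_sub, mul_sub,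
          mul_assoc, ← mul_assoc _ a c, center_comm (g ((j, i), 1)) a, mul_assoc a]
      rcases weyl_nzd h4 with h5 | h5
      · exact Subtype.ext h5
      · exact absurd (sub_eq_zero.1 h5) hne
    rintro ⟨⟨j, i⟩, ε⟩
    have h6 := h2 j i
    rw [h3 j i] at h6
    fin_cases ε
    · apply Subtype.ext
      simpa using h6
    · exact h3 j i
  haveI : Nontrivial (Weyl (ZMod p)) := ⟨⟨1, 0, weyl_one_ne⟩⟩
  have hcard := linearIndependent_le_span_finset v hv (Finset.univ.image (fun x : Fin p × Fin p =>
    Wx (ZMod p) ^ (x.1 : ℕ) * Wy (ZMod p) ^ (x.2 : ℕ))) (by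
      rw [Finset.coe_image, Finset.coe_univ, Set.image_univ]; exact span_center)
  have h7 : (Finset.univ.image (fun x : Fin p × Fin p =>
    Wx (ZMod p) ^ (x.1 : ℕ) * Wy (ZMod p) ^ (x.2 : ℕ))).card ≤ p * p := by
    refine Finset.card_image_le.trans ?_
    simp
  rw [Cardinal.mk_fintype] at hcard
  have h8 := (Nat.cast_le.1 hcard).trans h7
  simp at h8
  have : 0 < p * p := Nat.mul_pos hp hp
  omega

theorem expand_of_central (c : Weyl (ZMod p)) (hc : ∀ a, c * a = a * c) :
    ∃ φ : MvPolynomial (Fin 2) (ZMod p), sym c = expand p φ := by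
  have hx := comm_x c
  rw [hc, sub_self, map_zero] at hx
  have hy := comm_y c
  rw [hc, sub_self, map_zero] at hy
  have h0 : ∀ i : Fin 2, pderiv i (sym c) = 0 := by
    intro i
    fin_cases i
    · exact hy.symm
    · exact hx.symm
  have hd : ∀ e, coeff e (sym c) ≠ 0 → ∀ i, p ∣ e i := by
    intro e he i
    have h1 := coeff_euler (sym c) i e
    rw [h0 i, mul_zero, coeff_zero] at h1
    rcases mul_eq_zero.1 h1.symm with h2 | h2
    · exact (CharP.cast_eq_zero_iff (ZMod p) p _).1 h2
    · exact absurd h2 he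
  have : sym c ∈ (expand p (R := ZMod p) (σ := Fin 2)).range := by
    rw [← support_sum_monomial_coeff (sym c)]
    apply Subalgebra.sum_mem
    intro e he
    have h1 := hd e (mem_support_iff.1 he)
    refine ⟨monomial (e.mapRange (fun n => n / p) (by simp)) (coeff e (sym c)), ?_⟩
    change expand p _ = _
    rw [expand_monomial]
    congr 2
    refine Finsupp.ext fun i => ?_
    simp [Nat.mul_div_cancel' (h1 i)]
  obtain ⟨φ, hφ⟩ := this
  exact ⟨φ, hφ.symm⟩

theorem beta_expand (hodd : Odd p) (φ : MvPolynomial (Fin 2) (ZMod p)) (e : Fin 2 →₀ ℕ) :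
    coeff (p • e) (sym (beta (nord (expand p φ)))) = (-1) ^ (e 1) * coeff e φ := by
  have hp : p ≠ 0 := (Fact.out : p.Prime).ne_zero
  induction φ using MvPolynomial.induction_on' with
  | monomial d c =>
    have h1 : beta (nord (expand p (monomial d c))) = (-1 : ZMod p) ^ (d 1) • nord (expand p (monomial d c)) := by
      rw [expand_monomial, nord_monomial, beta_smul, beta_mul, beta_pow, beta_pow, beta_x, beta_y, smul_comm]
      congr 1
      simp only [Finsupp.smul_apply, smul_eq_mul, pow_mul]
      rw [Odd.neg_pow hodd (Wy (ZMod p))]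
      have h2 : Commute (Wy (ZMod p) ^ p) ((Wx (ZMod p) ^ p) ^ d 0) := yp_central _
      rw [neg_pow, mul_assoc, (h2.pow_left (d 1)).eq]
      rcases Nat.even_or_odd (d 1) with h | h
      · rw [h.neg_one_pow, h.neg_one_pow, one_mul, one_smul]
      · rw [h.neg_one_pow, h.neg_one_pow, neg_mul, one_mul]
        exact (neg_one_smul (ZMod p) _).symm
    rw [h1, map_smul, sym_nord, coeff_smul, coeff_expand_smul _ hp, coeff_monomial, smul_eq_mul]
    split_ifs with hde
    · rw [hde]
    · simp
  | add φ ψ h1 h2 =>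
    rw [map_add, map_add, beta_add, map_add, coeff_add, h1, h2, coeff_add]; ring

theorem charp_data (hodd : Odd p) (P Q : Weyl (ZMod p)) (h : Q * P = P * Q + 1)
    (hP : beta P = P) (hQ : beta Q = -Q) :
    ∃ φ ψ : MvPolynomial (Fin 2) (ZMod p), sym (P ^ p) = expand p φ ∧ sym (Q ^ p) = expand p ψ ∧
      (∀ e, coeff e φ ≠ 0 → Even (e 1)) ∧ (∀ e, coeff e ψ ≠ 0 → Odd (e 1)) ∧
      φ.totalDegree = (sym P).totalDegree ∧ ψ.totalDegree = (sym Q).totalDegree := by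
  have hp : p ≠ 0 := (Fact.out : p.Prime).ne_zero
  have hcm := comm_pow_p (p := p) (S := ZMod p) h
  obtain ⟨φ, hφ⟩ := expand_of_central (P ^ p) (centralizer_central P Q (P ^ p) h
    (by rw [← pow_succ, ← pow_succ']) hcm.1)
  obtain ⟨ψ, hψ⟩ := expand_of_central (Q ^ p) (centralizer_central P Q (Q ^ p) h
    hcm.2 (by rw [← pow_succ, ← pow_succ']))
  have hPne : P ≠ 0 := by
    rintro rfl
    rw [mul_zero, zero_mul, zero_add] at h
    exact weyl_one_ne h.symm
  have hQne : Q ≠ 0 := by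
    rintro rfl
    rw [mul_zero, zero_mul, zero_add] at h
    exact weyl_one_ne h.symm
  have h2 : (2 : ZMod p) ≠ 0 := by
    intro h2
    have h3 : ((2 : ℕ) : ZMod p) = 0 := by exact_mod_cast h2
    rw [CharP.cast_eq_zero_iff (ZMod p) p] at h3
    have := Nat.le_of_dvd (by norm_num) h3
    have := (Fact.out : p.Prime).two_le
    have : p = 2 := by omega
    rw [this] at hodd
    exact absurd hodd (by decide)
  refine ⟨φ, ψ, hφ, hψ, ?_, ?_, ?_, ?_⟩
  · intro e he
    by_contra ho
    rw [Nat.not_even_iff_odd] at ho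
    have h3 := beta_expand hodd φ e
    rw [← hφ, nord_sym, beta_pow, hP, hφ, coeff_expand_smul _ hp, ho.neg_one_pow] at h3
    apply he
    have h4 : (2 : ZMod p) * coeff e φ = 0 := by linear_combination h3
    exact (mul_eq_zero.1 h4).resolve_left h2
  · intro e he
    by_contra ho
    rw [Nat.not_odd_iff_even] at ho
    have h3 := beta_expand hodd ψ e
    rw [← hψ, nord_sym, beta_pow, hQ, Odd.neg_pow hodd Q, map_neg, hψ, coeff_neg, coeff_expand_smul _ hp, ho.neg_one_pow] at h3
    apply he
    have h4 : (2 : ZMod p) * coeff e ψ = 0 := by linear_combination -h3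
    exact (mul_eq_zero.1 h4).resolve_left h2
  · have h3 := (sym_pow_deg P hPne p).2
    rw [hφ, totalDegree_expand, mul_comm] at h3
    exact Nat.eq_of_mul_eq_mul_left (Nat.pos_of_ne_zero hp) h3
  · have h3 := (sym_pow_deg Q hQne p).2
    rw [hψ, totalDegree_expand, mul_comm] at h3
    exact Nat.eq_of_mul_eq_mul_left (Nat.pos_of_ne_zero hp) h3

end charp


theorem nord_mul_ypow {S : Type} [CommRing S] (g : MvPolynomial (Fin 2) S) (n : ℕ) :
    nord (g * X 1 ^ n) = nord g * Wy S ^ n := by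
  induction n with
  | zero => simp
  | succ n ih => rw [pow_succ, ← mul_assoc, ← nord_mul_y, ih, pow_succ, mul_assoc]

section modpsq
variable {p : ℕ} [Fact p.Prime]

def redp (p : ℕ) : ZMod (p ^ 2) →+* ZMod p := ZMod.castHom (dvd_pow_self p two_ne_zero) (ZMod p)

theorem redp_nat (n : ℕ) : redp p (n : ZMod (p ^ 2)) = n := map_natCast _ _

theorem psq_cases (x : ZMod (p ^ 2)) : ∃ n : ℕ, x = n := by
  have : NeZero (p ^ 2) := ⟨pow_ne_zero _ (Fact.out : p.Prime).ne_zero⟩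
  exact ⟨x.val, (ZMod.natCast_zmod_val x).symm⟩

theorem redp_zero (x : ZMod (p ^ 2)) (h : redp p x = 0) : ∃ y, x = (p : ZMod (p ^ 2)) * y := by
  obtain ⟨n, rfl⟩ := psq_cases x
  rw [redp_nat, ZMod.natCast_eq_zero_iff] at h
  obtain ⟨k, rfl⟩ := h
  exact ⟨k, by push_cast; rfl⟩

theorem redp_surj : Function.Surjective (redp p) := by
  intro y
  have : NeZero p := ⟨(Fact.out : p.Prime).ne_zero⟩
  exact ⟨(y.val : ZMod (p ^ 2)), by rw [redp_nat, ZMod.natCast_zmod_val]⟩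

def tau (p : ℕ) : ZMod (p ^ 2) := ((p.factorial : ℕ) : ZMod (p ^ 2))

theorem fact_eq : p.factorial = p * (p - 1).factorial :=
  (Nat.mul_factorial_pred (Fact.out : p.Prime).ne_zero).symm

theorem tau_cancel (x : ZMod (p ^ 2)) (h : tau p * x = 0) : redp p x = 0 := by
  obtain ⟨n, rfl⟩ := psq_cases x
  have hp := (Fact.out : p.Prime)
  rw [redp_nat, ZMod.natCast_eq_zero_iff]
  rw [tau, ← Nat.cast_mul, ZMod.natCast_eq_zero_iff, fact_eq, pow_two, mul_assoc] at h
  have h1 := Nat.dvd_of_mul_dvd_mul_left hp.pos h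
  rcases hp.dvd_mul.1 h1 with h2 | h2
  · rw [hp.dvd_factorial] at h2
    have := hp.pos
    omega
  · exact h2

theorem pp_zero : (p : ZMod (p ^ 2)) * p = 0 := by
  rw [← Nat.cast_mul, ZMod.natCast_eq_zero_iff, pow_two]

theorem tau_sq : tau p * tau p = 0 := by
  rw [tau, fact_eq]
  push_cast
  linear_combination ((p - 1).factorial : ZMod (p ^ 2)) ^ 2 * pp_zero (p := p)

theorem pderiv_iter {S : Type} [CommRing S] (m k : ℕ) :
    (((pderiv 0 : Derivation S (MvPolynomial (Fin 2) S) _).toLinearMap : Module.End S (MvPolynomial (Fin 2) S)) ^ k)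
      (X 0 ^ m) = (m.descFactorial k : MvPolynomial (Fin 2) S) * X 0 ^ (m - k) := by
  induction k with
  | zero => simp
  | succ k ih =>
    rw [pow_succ', Module.End.mul_apply, ih, Nat.descFactorial_succ]
    simp only [Derivation.coeFn_coe, Derivation.leibniz, Derivation.leibniz_pow, pderiv_X_self, smul_eq_mul,
      Derivation.map_natCast, nsmul_eq_mul]
    push_cast
    rw [Nat.sub_sub]
    ring

theorem VU : Wy (ZMod (p ^ 2)) ^ p * Wx (ZMod (p ^ 2)) ^ p =
    Wx (ZMod (p ^ 2)) ^ p * Wy (ZMod (p ^ 2)) ^ p + tau p • 1 := by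
  have hp := (Fact.out : p.Prime)
  apply sym_inj
  have hx : ∀ n, sym (Wx (ZMod (p ^ 2)) ^ n) = X 0 ^ n := by
    intro n
    rw [sym_def, wAct_xpow, mul_one]
  rw [sym_mul, hx, map_add, sym_mul, sym_ypow, wAct_xpow, map_smul, sym_one, map_pow (wAct (ZMod (p ^ 2)))]
  have hy : wAct (ZMod (p ^ 2)) (Wy (ZMod (p ^ 2))) =
      (pderiv 0).toLinearMap + LinearMap.mulLeft (ZMod (p ^ 2)) (X 1) := by
    apply LinearMap.ext
    intro g
    rw [wAct_y]
    simp [add_comm]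
  have hc : Commute ((pderiv 0 : Derivation (ZMod (p ^ 2)) (MvPolynomial (Fin 2) (ZMod (p ^ 2))) _).toLinearMap : Module.End _ _)
      (LinearMap.mulLeft (ZMod (p ^ 2)) (X 1)) := by
    apply LinearMap.ext
    intro g
    simp [Derivation.leibniz, pderiv_X]
  rw [hy, hc.add_pow, LinearMap.sum_apply]
  have ht : ∀ k ∈ Finset.range (p + 1), ((pderiv 0 : Derivation (ZMod (p ^ 2)) (MvPolynomial (Fin 2) (ZMod (p ^ 2))) _).toLinearMap ^ k
      * LinearMap.mulLeft (ZMod (p ^ 2)) (X 1) ^ (p - k) * ((p.choose k : ℕ) : Module.End (ZMod (p ^ 2)) (MvPolynomial (Fin 2) (ZMod (p ^ 2)))) : Module.End (ZMod (p ^ 2)) (MvPolynomial (Fin 2) (ZMod (p ^ 2)))) (X 0 ^ p) =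
      ((p.choose k * p.descFactorial k : ℕ) : MvPolynomial (Fin 2) (ZMod (p ^ 2))) * (X 1 ^ (p - k) * X 0 ^ (p - k)) := by
    intro k _
    have hc2 := (hc.pow_left k).pow_right (p - k)
    rw [hc2.eq, Module.End.mul_apply, Module.End.mul_apply]
    have h1 : ((p.choose k : ℕ) : Module.End (ZMod (p ^ 2)) (MvPolynomial (Fin 2) (ZMod (p ^ 2)))) (X 0 ^ p) = p.choose k • (X 0 ^ p) := by
      rw [Module.End.natCast_apply]
    rw [h1, map_nsmul, pderiv_iter, map_nsmul, LinearMap.pow_mulLeft, LinearMap.mulLeft_apply, nsmul_eq_mul]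
    push_cast
    ring
  rw [Finset.sum_congr rfl ht, Finset.sum_range_succ]
  obtain ⟨k, hk⟩ : ∃ k, p = k + 1 := ⟨p - 1, by have := hp.pos; omega⟩
  rw [Finset.sum_eq_single_of_mem 0 (by simp [hp.pos])]
  · simp only [Nat.choose_zero_right, Nat.descFactorial_zero, Nat.choose_self, Nat.descFactorial_self, Nat.sub_self,
      Nat.sub_zero, pow_zero, mul_one, one_mul, Nat.cast_one]
    rw [mul_comm, tau, smul_eq_C_mul, map_natCast, mul_one]
  · intro k hk hk0
    have hkp : k < p := Finset.mem_range.1 hk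
    have h1 : p ∣ p.choose k := hp.dvd_choose_self hk0 hkp
    have h2 : p ∣ p.descFactorial k := by
      obtain ⟨a, rfl⟩ : ∃ a, k = a + 1 := ⟨k - 1, by omega⟩
      obtain ⟨b, hb⟩ : ∃ b, p = b + 1 := ⟨p - 1, by omega⟩
      conv_rhs => rw [hb, Nat.succ_descFactorial_succ]
      rw [← hb]
      exact dvd_mul_right _ _
    have h3 : ((p.choose k * p.descFactorial k : ℕ) : ZMod (p ^ 2)) = 0 := by
      rw [ZMod.natCast_eq_zero_iff, pow_two]
      exact Nat.mul_dvd_mul h1 h2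
    rw [← map_natCast (C : ZMod (p ^ 2) →+* MvPolynomial (Fin 2) (ZMod (p ^ 2))), h3, map_zero, zero_mul]

def TT (p : ℕ) : MvPolynomial (Fin 2) (ZMod (p ^ 2)) →ₗ[ZMod (p ^ 2)] Weyl (ZMod (p ^ 2)) :=
  nord.comp (expand p).toLinearMap

theorem TT_def (φ : MvPolynomial (Fin 2) (ZMod (p ^ 2))) : TT p φ = nord (expand p φ) := rfl

theorem TT_monomial (e : Fin 2 →₀ ℕ) (c : ZMod (p ^ 2)) : TT p (monomial e c) =
    c • ((Wx (ZMod (p ^ 2)) ^ p) ^ e 0 * (Wy (ZMod (p ^ 2)) ^ p) ^ e 1) := by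
  rw [TT_def, expand_monomial, nord_monomial]
  simp [pow_mul]

theorem TT_x (φ : MvPolynomial (Fin 2) (ZMod (p ^ 2))) : TT p (X 0 * φ) = Wx (ZMod (p ^ 2)) ^ p * TT p φ := by
  rw [TT_def, TT_def, map_mul, expand_X, mul_nord, wAct_xpow]

theorem TT_y (φ : MvPolynomial (Fin 2) (ZMod (p ^ 2))) : TT p (φ * X 1) = TT p φ * Wy (ZMod (p ^ 2)) ^ p := by
  rw [TT_def, TT_def, map_mul, expand_X]
  exact nord_mul_ypow _ _

theorem TT_C (c : ZMod (p ^ 2)) : TT p (C c) = c • 1 := by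
  have := TT_monomial (p := p) 0 c
  simpa using this

theorem q_tpow {F A : Type} [CommRing F] [Ring A] [Algebra F A] {q t : A} {s : F}
    (h : q * t = t * q + s • 1) (n : ℕ) :
    q * t ^ (n + 1) = t ^ (n + 1) * q + ((n + 1 : ℕ) * s) • t ^ n := by
  induction n with
  | zero => simp [h]
  | succ n ih =>
    rw [pow_succ t (n + 1), ← mul_assoc, ih, add_mul, mul_assoc, h, mul_add, mul_smul_comm,
      smul_mul_assoc, mul_one, ← pow_succ, ← mul_assoc, ← pow_succ, add_assoc, ← add_smul]
    congr 2
    push_cast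
    ring

theorem V_TT (ψ : MvPolynomial (Fin 2) (ZMod (p ^ 2))) :
    Wy (ZMod (p ^ 2)) ^ p * TT p ψ = TT p ψ * Wy (ZMod (p ^ 2)) ^ p + tau p • TT p (pderiv 0 ψ) := by
  induction ψ using MvPolynomial.induction_on' with
  | monomial e c =>
    rw [pderiv_monomial, TT_monomial, TT_monomial, mul_smul_comm, ← mul_assoc]
    rcases h : e 0 with _ | n
    · simp only [pow_zero, mul_one, one_mul, Nat.cast_zero, mul_zero, zero_smul, smul_zero, add_zero,
        smul_mul_assoc]
      rw [← pow_succ, ← pow_succ']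
    · rw [q_tpow VU, add_mul, smul_add]
      congr 1
      · rw [mul_assoc, ← pow_succ', smul_mul_assoc, mul_assoc, ← pow_succ]
      · rw [smul_mul_assoc, smul_smul, smul_smul]
        have h1 : (e - Finsupp.single 0 1 : Fin 2 →₀ ℕ) 0 = n := by simp [h]
        have h2 : (e - Finsupp.single 0 1 : Fin 2 →₀ ℕ) 1 = e 1 := by simp
        rw [h1, h2]
        congr 1
        ring
  | add φ ψ h1 h2 => simp only [map_add, mul_add, add_mul, h1, h2, smul_add]; abel

theorem TT_U (ψ : MvPolynomial (Fin 2) (ZMod (p ^ 2))) :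
    TT p ψ * Wx (ZMod (p ^ 2)) ^ p = Wx (ZMod (p ^ 2)) ^ p * TT p ψ + tau p • TT p (pderiv 1 ψ) := by
  induction ψ using MvPolynomial.induction_on' with
  | monomial e c =>
    rw [pderiv_monomial, TT_monomial, TT_monomial, smul_mul_assoc, mul_assoc]
    rcases h : e 1 with _ | n
    · simp only [pow_zero, mul_one, one_mul, Nat.cast_zero, mul_zero, zero_smul, smul_zero, add_zero,
        mul_smul_comm]
      rw [← pow_succ, ← pow_succ']
    · rw [qpow_t VU, mul_add, smul_add]
      congr 1
      · rw [← mul_assoc, ← pow_succ, mul_smul_comm, ← mul_assoc, ← pow_succ']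
      · rw [mul_smul_comm, smul_smul, smul_smul]
        have h1 : (e - Finsupp.single 1 1 : Fin 2 →₀ ℕ) 1 = n := by simp [h]
        have h2 : (e - Finsupp.single 1 1 : Fin 2 →₀ ℕ) 0 = e 0 := by simp
        rw [h1, h2]
        congr 1
        ring
  | add φ ψ h1 h2 => simp only [map_add, mul_add, add_mul, h1, h2, smul_add]; abel

theorem TT_mul (φ ψ : MvPolynomial (Fin 2) (ZMod (p ^ 2))) :
    tau p • TT p (φ * ψ) = tau p • (TT p φ * TT p ψ) := by
  revert ψ
  induction φ using MvPolynomial.induction_on with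
  | C c =>
    intro ψ
    rw [TT_C, ← smul_eq_C_mul, map_smul, smul_mul_assoc, one_mul]
  | add φ φ' h1 h2 => intro ψ; rw [add_mul, map_add, smul_add, h1, h2, map_add, add_mul, smul_add]
  | mul_X φ i ih =>
    intro ψ
    fin_cases i
    · change tau p • TT p (φ * X 0 * ψ) = tau p • (TT p (φ * X 0) * TT p ψ)
      rw [mul_assoc, ih, TT_x, mul_comm φ, TT_x, ← mul_assoc, TT_U, add_mul, smul_add, smul_mul_assoc, smul_smul,
        tau_sq, zero_smul, add_zero]
    · change tau p • TT p (φ * X 1 * ψ) = tau p • (TT p (φ * X 1) * TT p ψ)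
      rw [mul_assoc, ih, TT_y, mul_comm (X 1) ψ, TT_y, mul_assoc (TT p φ), V_TT, mul_add, smul_add, mul_smul_comm,
        smul_smul, tau_sq, zero_smul, add_zero]

theorem TT_comm (φ ψ : MvPolynomial (Fin 2) (ZMod (p ^ 2))) :
    TT p φ * TT p ψ = TT p ψ * TT p φ +
      tau p • TT p (pderiv 1 φ * pderiv 0 ψ - pderiv 0 φ * pderiv 1 ψ) := by
  induction φ using MvPolynomial.induction_on with
  | C c => simp [TT_C]
  | add φ φ' h1 h2 =>
    have : pderiv 1 (φ + φ') * pderiv 0 ψ - pderiv 0 (φ + φ') * pderiv 1 ψ =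
      (pderiv 1 φ * pderiv 0 ψ - pderiv 0 φ * pderiv 1 ψ) + (pderiv 1 φ' * pderiv 0 ψ - pderiv 0 φ' * pderiv 1 ψ) := by
      simp only [map_add]; ring
    rw [this, map_add, add_mul, h1, h2, map_add, mul_add, smul_add]; abel
  | mul_X φ i ih =>
    fin_cases i
    · change TT p (φ * X 0) * TT p ψ = TT p ψ * TT p (φ * X 0) +
        tau p • TT p (pderiv 1 (φ * X 0) * pderiv 0 ψ - pderiv 0 (φ * X 0) * pderiv 1 ψ)
      have h1 : pderiv 1 (φ * X 0) * pderiv 0 ψ - pderiv 0 (φ * X 0) * pderiv 1 ψ =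
          X 0 * (pderiv 1 φ * pderiv 0 ψ - pderiv 0 φ * pderiv 1 ψ) - pderiv 1 ψ * φ := by
        simp only [Derivation.leibniz, pderiv_X_self, pderiv_X_of_ne (show (1 : Fin 2) ≠ 0 by decide),
          pderiv_X_of_ne (show (0 : Fin 2) ≠ 1 by decide), smul_eq_mul]
        ring
      rw [h1, map_sub, smul_sub, TT_mul (pderiv 1 ψ) φ, TT_x, mul_comm φ, TT_x, mul_assoc, ih, ← mul_assoc (TT p ψ), TT_U,
        add_mul, mul_add, ← mul_assoc, mul_smul_comm, smul_mul_assoc]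
      abel
    · change TT p (φ * X 1) * TT p ψ = TT p ψ * TT p (φ * X 1) +
        tau p • TT p (pderiv 1 (φ * X 1) * pderiv 0 ψ - pderiv 0 (φ * X 1) * pderiv 1 ψ)
      have h1 : pderiv 1 (φ * X 1) * pderiv 0 ψ - pderiv 0 (φ * X 1) * pderiv 1 ψ =
          (pderiv 1 φ * pderiv 0 ψ - pderiv 0 φ * pderiv 1 ψ) * X 1 + φ * pderiv 0 ψ := by
        simp only [Derivation.leibniz, pderiv_X_self, pderiv_X_of_ne (show (1 : Fin 2) ≠ 0 by decide),
          pderiv_X_of_ne (show (0 : Fin 2) ≠ 1 by decide), smul_eq_mul]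
        ring
      rw [h1, map_add, smul_add, TT_mul φ (pderiv 0 ψ), TT_y, TT_y, mul_assoc, V_TT, mul_add, ← mul_assoc, ih, add_mul,
        mul_smul_comm, smul_mul_assoc, mul_assoc]
      abel
end modpsq


section bracket
variable {p : ℕ} [Fact p.Prime]

theorem poly_redp (g : MvPolynomial (Fin 2) (ZMod (p ^ 2))) (h : map (redp p) g = 0) :
    ∃ g', g = (p : ZMod (p ^ 2)) • g' := by
  have : C (p : ZMod (p ^ 2)) ∣ g := by
    rw [C_dvd_iff_dvd_coeff]
    intro e
    apply redp_zero
    rw [← coeff_map, h, coeff_zero]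
  obtain ⟨g', hg⟩ := this
  exact ⟨g', by rw [hg, smul_eq_C_mul]⟩

theorem weyl_redp (a b : Weyl (ZMod (p ^ 2))) (h : mapW (redp p) a = mapW (redp p) b) :
    ∃ w, a = b + (p : ZMod (p ^ 2)) • w := by
  have h1 : map (redp p) (sym a - sym b) = 0 := by
    rw [map_sub, ← sym_mapW, ← sym_mapW, h, sub_self]
  obtain ⟨g', hg⟩ := poly_redp _ h1
  refine ⟨nord g', ?_⟩
  apply sym_inj
  rw [map_add, map_smul, sym_nord, ← hg, add_sub_cancel]

theorem p_smul_eq (a b : Weyl (ZMod (p ^ 2))) (h : mapW (redp p) a = mapW (redp p) b) :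
    (p : ZMod (p ^ 2)) • a = (p : ZMod (p ^ 2)) • b := by
  obtain ⟨w, rfl⟩ := weyl_redp a b h
  rw [smul_add, smul_smul, pp_zero, zero_smul, add_zero]

theorem ring_aux {F A : Type} [CommRing F] [Ring A] [Algebra F A] {q : F} (hq : q * q = 0) {U V w1 w2 : A}
    (h1 : q • (w2 * U) = q • (U * w2)) (h2 : q • (w1 * V) = q • (V * w1)) (s t : A)
    (hs : V * U = U * V + s) (ht : (V + q • w2) * (U + q • w1) = (U + q • w1) * (V + q • w2) + t) : t = s := by
  simp only [add_mul, mul_add, smul_add, smul_mul_assoc, mul_smul_comm, smul_smul, hq, zero_smul, add_zero, h1, h2, hs] at ht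
  have : U * V + q • (U * w2) + q • (V * w1) + s = U * V + q • (U * w2) + q • (V * w1) + t := by
    calc _ = U * V + s + q • (U * w2) + q • (V * w1) := by abel
      _ = _ := by
        exact ht.trans (by abel)
  exact (add_left_cancel this).symm

theorem bracket_one (P Q : Weyl (ZMod (p ^ 2))) (h : Q * P = P * Q + 1)
    (φ ψ : MvPolynomial (Fin 2) (ZMod p))
    (hφ : sym ((mapW (redp p) P) ^ p) = expand p φ) (hψ : sym ((mapW (redp p) Q) ^ p) = expand p ψ) :
    pderiv 0 φ * pderiv 1 ψ - pderiv 1 φ * pderiv 0 ψ = 1 := by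
  have hp := (Fact.out : p.Prime)
  obtain ⟨φ', rfl⟩ := MvPolynomial.map_surjective (redp p) redp_surj φ
  obtain ⟨ψ', rfl⟩ := MvPolynomial.map_surjective (redp p) redp_surj ψ
  have key : ∀ g : MvPolynomial (Fin 2) (ZMod (p ^ 2)), mapW (redp p) (TT p g) = nord (expand p (map (redp p) g)) := by
    intro g
    rw [TT_def, mapW_nord, map_expand]
  have hU : mapW (redp p) (TT p φ') = mapW (redp p) P ^ p := by
    rw [key, ← hφ, nord_sym]
  have hV : mapW (redp p) (TT p ψ') = mapW (redp p) Q ^ p := by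
    rw [key, ← hψ, nord_sym]
  have hr : mapW (redp p) Q * mapW (redp p) P = mapW (redp p) P * mapW (redp p) Q + 1 := by
    rw [← map_mul, h, map_add, map_mul, map_one]
  have hcP : ∀ a, mapW (redp p) P ^ p * a = a * mapW (redp p) P ^ p :=
    centralizer_central _ _ _ hr (by rw [← pow_succ, pow_succ']) (comm_pow_p (p := p) (S := ZMod p) hr).1
  have hcQ : ∀ a, mapW (redp p) Q ^ p * a = a * mapW (redp p) Q ^ p :=
    centralizer_central _ _ _ hr (comm_pow_p (p := p) (S := ZMod p) hr).2 (by rw [← pow_succ, pow_succ'])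
  obtain ⟨w1, hw1⟩ := weyl_redp (P ^ p) (TT p φ') (by rw [hU, map_pow])
  obtain ⟨w2, hw2⟩ := weyl_redp (Q ^ p) (TT p ψ') (by rw [hV, map_pow])
  have hPQ : Q ^ p * P ^ p = P ^ p * Q ^ p + tau p • 1 := by
    have := congrArg (wLift (S := ZMod (p ^ 2)) P Q h) (VU (p := p))
    rw [map_mul, map_pow, map_pow, map_add, map_mul, map_pow, map_pow, wLift_x, wLift_y, map_smul, map_one] at this
    exact this
  rw [hw1, hw2] at hPQ
  have hfin := ring_aux (q := (p : ZMod (p ^ 2))) pp_zero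
    (p_smul_eq _ _ (by rw [map_mul, map_mul, hU, hcP])) (p_smul_eq _ _ (by rw [map_mul, map_mul, hV, hcQ])) _ _
    (TT_comm ψ' φ') hPQ
  have h2 := congrArg sym hfin
  rw [map_smul, map_smul, sym_one, TT_def, sym_nord] at h2
  have h3 : map (redp p) (pderiv 1 ψ' * pderiv 0 φ' - pderiv 0 ψ' * pderiv 1 φ') = 1 := by
    rw [← sub_eq_zero, ← map_one (map (redp p)), ← map_sub]
    ext e
    rw [coeff_map, coeff_zero]
    apply tau_cancel
    have h4 := congrArg (coeff (p • e)) h2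
    rw [← (map_one (expand p) : expand p (1 : MvPolynomial (Fin 2) (ZMod (p ^ 2))) = 1), coeff_smul, coeff_smul,
      coeff_expand_smul _ hp.ne_zero, coeff_expand_smul _ hp.ne_zero, smul_eq_mul, smul_eq_mul] at h4
    rw [coeff_sub, mul_sub, h4, sub_self]
  rw [← h3, map_sub, map_mul, map_mul, pderiv_map, pderiv_map, pderiv_map, pderiv_map]
  ring
end bracket


theorem exists_prime_dvd_poly (H : Polynomial ℤ) (hH : H.natDegree ≠ 0) (N : ℕ) :
    ∃ (p : ℕ) (n : ℤ), p.Prime ∧ N < p ∧ (p : ℤ) ∣ H.eval n := by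
  by_cases hc : H.eval 0 = 0
  · obtain ⟨p, hp1, hp2⟩ := Nat.exists_infinite_primes (N + 1)
    exact ⟨p, 0, hp2, by omega, by rw [hc]; exact dvd_zero _⟩
  · set c := H.eval 0 with hcdef
    set M : ℤ := (N.factorial : ℤ) with hM
    have hMne : M ≠ 0 := by rw [hM]; exact_mod_cast N.factorial_ne_zero
    have hG : (H - Polynomial.C c) * (H + Polynomial.C c) ≠ 0 := by
      refine mul_ne_zero ?_ ?_
      · intro h
        rw [sub_eq_zero] at h
        rw [h] at hH; simp at hH
      · intro h
        rw [add_eq_zero_iff_eq_neg, ← Polynomial.C_neg] at h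
        rw [h] at hH; simp at hH
    obtain ⟨t, ht⟩ : ∃ t : ℤ, ((H - Polynomial.C c) * (H + Polynomial.C c)).eval (c * M * t) ≠ 0 := by
      by_contra! hall
      apply hG
      apply Polynomial.eq_zero_of_infinite_isRoot
      refine Set.infinite_of_injective_forall_mem (f := fun t : ℤ => c * M * t) ?_ hall
      intro a b hab
      exact mul_left_cancel₀ (mul_ne_zero hc hMne) hab
    have hd : c * M * t - 0 ∣ H.eval (c * M * t) - H.eval 0 := Polynomial.sub_dvd_eval_sub _ _ _
    obtain ⟨k, hk⟩ := hd
    have hv : H.eval (c * M * t) = c * (1 + M * t * k) := by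
      rw [← hcdef] at hk
      linear_combination hk
    have hm : (1 + M * t * k).natAbs ≠ 1 := by
      intro h1
      apply ht
      rw [Polynomial.eval_mul, Polynomial.eval_sub, Polynomial.eval_add, Polynomial.eval_C, hv]
      rcases Int.natAbs_eq_iff.1 h1 with h | h
      · rw [h]; simp
      · rw [h]; simp
    obtain ⟨p, hp, hpd⟩ := Nat.exists_prime_and_dvd hm
    have hpd' : (p : ℤ) ∣ 1 + M * t * k := Int.natCast_dvd.2 hpd
    refine ⟨p, c * M * t, hp, ?_, by rw [hv]; exact Dvd.dvd.mul_left hpd' _⟩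
    by_contra hlt
    have h1 : p ∣ N.factorial := (hp.dvd_factorial).2 (by omega)
    have h2 : (p : ℤ) ∣ M * t * k := by
      rw [mul_assoc]
      exact Dvd.dvd.mul_right (Int.natCast_dvd_natCast.2 h1) _
    have h3 : (p : ℤ) ∣ 1 := (dvd_add_left h2).1 hpd'
    have h4 : p ∣ 1 := by exact_mod_cast h3
    exact hp.one_lt.ne' (Nat.dvd_one.1 h4)

theorem clear_den (g : Polynomial ℚ) : ∃ (d : ℤ) (G : Polynomial ℤ), d ≠ 0 ∧
    G.map (Int.castRingHom ℚ) = Polynomial.C (d : ℚ) * g := by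
  obtain ⟨b, hb, h⟩ := IsLocalization.integerNormalization_spec (nonZeroDivisors ℤ) g
  refine ⟨b, IsLocalization.integerNormalization (nonZeroDivisors ℤ) g, nonZeroDivisors.ne_zero hb, ?_⟩
  rw [← Polynomial.smul_eq_C_mul]
  refine Eq.trans ?_ (h.trans ?_)
  · rfl
  · ext; simp

theorem exists_padic_root (h : Polynomial ℚ) (hdeg : h.natDegree ≠ 0) (hs : h.Separable) (N : ℕ) :
    ∃ (p : ℕ) (_ : Fact p.Prime) (z : ℤ_[p]), N < p ∧ Polynomial.aeval (z : ℚ_[p]) h = 0 := by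
  obtain ⟨d, H, hd, hH⟩ := clear_den h
  obtain ⟨a, b, hab⟩ := hs
  obtain ⟨d1, A, hd1, hA⟩ := clear_den a
  obtain ⟨d2, B, hd2, hB⟩ := clear_den b
  have hder : (Polynomial.derivative H).map (Int.castRingHom ℚ) = Polynomial.C (d : ℚ) * Polynomial.derivative h := by
    rw [← Polynomial.derivative_map, hH, Polynomial.derivative_C_mul]
  have hbez : Polynomial.C d2 * A * H + Polynomial.C d1 * B * Polynomial.derivative H = Polynomial.C (d * d1 * d2) := by
    apply Polynomial.map_injective (Int.castRingHom ℚ) Int.cast_injective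
    simp only [Polynomial.map_add, Polynomial.map_mul, hA, hB, hH, hder, Polynomial.map_C, map_mul]
    simp only [eq_intCast]
    linear_combination (Polynomial.C (d:ℚ) * Polynomial.C (d1:ℚ) * Polynomial.C (d2 : ℚ)) * hab
  have hHdeg : H.natDegree ≠ 0 := by
    have h1 : (H.map (Int.castRingHom ℚ)).natDegree = H.natDegree :=
      Polynomial.natDegree_map_eq_of_injective Int.cast_injective H
    rw [← h1, hH, Polynomial.natDegree_C_mul (by exact_mod_cast hd)]
    exact hdeg
  obtain ⟨p, n, hp, hpN, hpd⟩ := exists_prime_dvd_poly H hHdeg (max N (d * d1 * d2).natAbs)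
  haveI : Fact p.Prime := ⟨hp⟩
  have hΔ : ¬ (p : ℤ) ∣ d * d1 * d2 := by
    intro hdv
    have h1 := Int.natCast_dvd.1 hdv
    have h2 := Nat.le_of_dvd (Int.natAbs_pos.2 (mul_ne_zero (mul_ne_zero hd hd1) hd2)) h1
    have := le_max_right N (d * d1 * d2).natAbs
    omega
  have hev : ∀ G : Polynomial ℤ, Polynomial.aeval (n : ℤ_[p]) G = ((G.eval n : ℤ) : ℤ_[p]) := by
    intro G
    have := Polynomial.aeval_algebraMap_apply ℤ_[p] n G
    simpa using this
  have hn' : ‖Polynomial.aeval (n : ℤ_[p]) (Polynomial.derivative H)‖ = 1 := by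
    rw [hev]
    refine le_antisymm (PadicInt.norm_le_one _) ?_
    by_contra hlt
    rw [not_le, PadicInt.norm_int_lt_one_iff_dvd] at hlt
    apply hΔ
    have := congrArg (Polynomial.eval n) hbez
    simp only [Polynomial.eval_add, Polynomial.eval_mul, Polynomial.eval_C] at this
    rw [← this]
    exact dvd_add (Dvd.dvd.mul_left hpd _) (Dvd.dvd.mul_left hlt _)
  have hn : ‖Polynomial.aeval (n : ℤ_[p]) H‖ < 1 := by
    rw [hev, PadicInt.norm_int_lt_one_iff_dvd]; exact hpd
  obtain ⟨z, hz, -⟩ := hensels_lemma (F := H) (a := (n : ℤ_[p])) (by rw [hn']; simpa using hn)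
  refine ⟨p, ⟨hp⟩, z, lt_of_le_of_lt (le_max_left _ _) hpN, ?_⟩
  have h1 : Polynomial.aeval (z : ℚ_[p]) H = 0 := by
    have := Polynomial.aeval_algebraMap_apply ℚ_[p] z H
    rw [hz, map_zero] at this
    exact this
  have h2 : Polynomial.aeval (z : ℚ_[p]) (H.map (Int.castRingHom ℚ)) = 0 := by
    rw [← h1]
    have := Polynomial.aeval_map_algebraMap ℚ (z : ℚ_[p]) H
    exact this
  rw [hH, map_mul, Polynomial.aeval_C] at h2
  rcases mul_eq_zero.1 h2 with h3 | h3
  · exfalso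
    apply hd
    rw [map_eq_zero] at h3
    exact_mod_cast h3
  · exact h3

theorem exists_residue (A : Type) [CommRing A] [Nontrivial A] [Algebra ℚ A] [Algebra.FiniteType ℚ A] :
    ∃ (L : Type) (_ : Field L) (_ : Algebra ℚ L) (_ : Module.Finite ℚ L), Nonempty (A →+* L) := by
  obtain ⟨m, hm⟩ := Ideal.exists_maximal A
  exact ⟨A ⧸ m, Ideal.Quotient.field m, inferInstance,
    @finite_of_finite_type_of_isJacobsonRing ℚ (A ⧸ m) _ (Ideal.Quotient.field m) _ _ _, ⟨Ideal.Quotient.mk m⟩⟩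

theorem spec_exists (K : Type) [Field K] [CharZero K] (s : Finset K) (N : ℕ) :
    ∃ (p : ℕ) (_ : Fact p.Prime), N < p ∧ Nonempty (Subring.closure (s : Set K) →+* ℤ_[p]) := by
  let A := Algebra.adjoin ℚ (s : Set K)
  haveI : Algebra.FiniteType ℚ A := Subalgebra.fg_iff_finiteType A |>.1 (Subalgebra.fg_adjoin_finset s)
  obtain ⟨L, _, _, _, ⟨π⟩⟩ := exists_residue A
  let pb := Field.powerBasisOfFiniteOfSeparable ℚ L
  have hle : Subring.closure (s : Set K) ≤ A.toSubring := Subring.closure_le.2 Algebra.subset_adjoin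
  let ι : Subring.closure (s : Set K) →+* L := π.comp (Subring.inclusion hle)
  have hpoly : ∀ y : L, ∃ g : Polynomial ℚ, y = Polynomial.aeval pb.gen g := fun y =>
    pb.exists_eq_aeval' y
  choose g hg using hpoly
  -- bound
  have hbound : ∃ N' : ℕ, ∀ x (hx : x ∈ s) (k : ℕ),
      ((g (ι ⟨x, Subring.subset_closure hx⟩)).coeff k).den ≤ N' := by
    classical
    refine ⟨∑ x ∈ s.attach, ∑ k ∈ (g (ι ⟨x.1, Subring.subset_closure x.2⟩)).support,
      ((g (ι ⟨x.1, Subring.subset_closure x.2⟩)).coeff k).den + 1, ?_⟩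
    intro x hx k
    by_cases hk : k ∈ (g (ι ⟨x, Subring.subset_closure hx⟩)).support
    · have h1 := Finset.single_le_sum (f := fun k => ((g (ι ⟨x, Subring.subset_closure hx⟩)).coeff k).den)
        (fun i _ => Nat.zero_le _) hk
      have h2 := Finset.single_le_sum (f := fun x : s => ∑ k ∈ (g (ι ⟨x.1, Subring.subset_closure x.2⟩)).support,
        ((g (ι ⟨x.1, Subring.subset_closure x.2⟩)).coeff k).den)
        (fun i _ => Nat.zero_le _) (Finset.mem_attach s ⟨x, hx⟩)
      simp only at h1 h2
      omega
    · rw [Polynomial.notMem_support_iff.1 hk]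
      simp
  obtain ⟨N', hN'⟩ := hbound
  have hsep : (minpoly ℚ pb.gen).Separable := Algebra.IsSeparable.isSeparable ℚ pb.gen
  obtain ⟨p, hp, z, hpN, hz⟩ := exists_padic_root (minpoly ℚ pb.gen)
    (minpoly.natDegree_pos (Algebra.IsIntegral.isIntegral pb.gen)).ne' hsep (max N N')
  refine ⟨p, hp, lt_of_le_of_lt (le_max_left _ _) hpN, ?_⟩
  let ψ := pb.lift (z : ℚ_[p]) hz
  let ρ : Subring.closure (s : Set K) →+* ℚ_[p] := (ψ : L →+* ℚ_[p]).comp ι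
  have hρ : ∀ x, ρ x ∈ PadicInt.subring p := by
    rintro ⟨x, hx⟩
    induction hx using Subring.closure_induction with
    | mem x hx =>
      change ψ (ι ⟨x, _⟩) ∈ _
      rw [hg (ι ⟨x, _⟩), ← Polynomial.aeval_algHom_apply]
      change Polynomial.aeval (pb.lift (z : ℚ_[p]) hz pb.gen) _ ∈ _
      rw [PowerBasis.lift_gen, Polynomial.aeval_eq_sum_range]
      apply Subring.sum_mem
      intro k _
      rw [Algebra.smul_def]
      apply Subring.mul_mem
      · change ‖_‖ ≤ _
        rw [eq_ratCast]
        apply Padic.norm_rat_le_one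
        intro hdv
        have h1 := Nat.le_of_dvd (Rat.den_pos _) hdv
        have h2 := hN' x hx k
        have h3 := le_max_right N N'
        omega
      · exact Subring.pow_mem _ z.2 k
    | zero => change ρ 0 ∈ _; rw [map_zero]; exact Subring.zero_mem _
    | one => change ρ 1 ∈ _; rw [map_one]; exact Subring.one_mem _
    | add x y hx hy h1 h2 =>
      have := Subring.add_mem _ h1 h2
      rw [← map_add] at this
      exact this
    | neg x hx h1 =>
      have := Subring.neg_mem _ h1
      rw [← map_neg] at this
      exact this
    | mul x y hx hy h1 h2 =>
      have := Subring.mul_mem _ h1 h2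
      rw [← map_mul] at this
      exact this
  exact ⟨RingHom.codRestrict ρ (PadicInt.subring p) hρ⟩


theorem mapW_inj {S S' : Type} [CommRing S] [CommRing S'] (σ : S →+* S') (hσ : Function.Injective σ) :
    Function.Injective (mapW σ) := by
  intro a b h
  apply sym_inj
  apply map_injective σ hσ
  rw [← sym_mapW, ← sym_mapW, h]

theorem mapW_neg {S S' : Type} [CommRing S] [CommRing S'] (σ : S →+* S') (a : Weyl S) :
    mapW σ (-a) = - mapW σ a := map_neg _ _

theorem tdeg_map_le {S S' : Type} [CommRing S] [CommRing S'] (σ : S →+* S') (g : MvPolynomial (Fin 2) S) (n : ℕ)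
    (h : g.totalDegree ≤ n) : (map σ g).totalDegree ≤ n := by
  rw [tdeg_le_iff] at h ⊢
  intro e he
  apply h
  intro h0
  rw [coeff_map, h0, map_zero] at he
  exact he rfl

theorem modp_deg (p : ℕ) [Fact p.Prime] (hodd : Odd p) (D : ℕ) (hD : D * D < p) (P Q : Weyl (ZMod (p ^ 2)))
    (h : Q * P = P * Q + 1) (hP : beta P = P) (hQ : beta Q = -Q) (hdP : (sym P).totalDegree ≤ D)
    (hdQ : (sym Q).totalDegree ≤ D) : (sym (mapW (redp p) Q)).totalDegree ≤ 1 := by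
  have hr : mapW (redp p) Q * mapW (redp p) P = mapW (redp p) P * mapW (redp p) Q + 1 := by
    rw [← map_mul, h, map_add, map_mul, map_one]
  obtain ⟨φ, ψ, h1, h2, h3, h4, h5, h6⟩ := charp_data hodd (mapW (redp p) P) (mapW (redp p) Q) hr
    (by rw [← mapW_beta, hP]) (by rw [← mapW_beta, hQ, mapW_neg])
  have hb := bracket_one P Q h φ ψ h1 h2
  rw [← h6]
  refine comm_lemma p D hD φ ψ hb h3 h4 ?_ ?_
  · rw [h5, sym_mapW]; exact tdeg_map_le _ _ _ hdP
  · rw [h6, sym_mapW]; exact tdeg_map_le _ _ _ hdQ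

theorem core_deg {K : Type} [Field K] [CharZero K] (P Q : Weyl K) (h : Q * P = P * Q + 1)
    (hP : beta P = P) (hQ : beta Q = -Q) : (sym Q).totalDegree ≤ 1 := by
  classical
  have hQ0 : sym Q ≠ 0 := by
    intro h0
    have : Q = 0 := sym_inj (by rw [h0, map_zero])
    rw [this, zero_mul, mul_zero, zero_add] at h
    exact weyl_one_ne h.symm
  obtain ⟨e, he, hdeg⟩ := exists_top _ hQ0
  set D := (sym P).totalDegree + (sym Q).totalDegree with hDdef
  set s : Finset K := (sym P).coeffs ∪ (sym Q).coeffs ∪ {(coeff e (sym Q))⁻¹} with hs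
  obtain ⟨p, hpF, hpN, ⟨θ⟩⟩ := spec_exists K s (D * D + 2)
  have hp := hpF.out
  let R := Subring.closure (s : Set K)
  have hsub : (s : Set K) ⊆ Set.range R.subtype := by
    intro x hx
    exact ⟨⟨x, Subring.subset_closure hx⟩, rfl⟩
  obtain ⟨g1, hg1⟩ : sym P ∈ Set.range (map R.subtype) :=
    mem_range_map_iff_coeffs_subset.2 (fun x hx => hsub (by simp [hs] at hx ⊢; tauto))
  obtain ⟨g2, hg2⟩ : sym Q ∈ Set.range (map R.subtype) :=
    mem_range_map_iff_coeffs_subset.2 (fun x hx => hsub (by simp [hs] at hx ⊢; tauto))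
  obtain ⟨c, hc⟩ : (coeff e (sym Q))⁻¹ ∈ Set.range R.subtype := hsub (by simp [hs])
  have hinj : Function.Injective R.subtype := Subtype.val_injective
  have hP' : mapW R.subtype (nord g1) = P := by rw [mapW_nord, hg1, nord_sym]
  have hQ' : mapW R.subtype (nord g2) = Q := by rw [mapW_nord, hg2, nord_sym]
  have hW := mapW_inj R.subtype hinj
  have r1 : nord g2 * nord g1 = nord g1 * nord g2 + 1 := by
    apply hW
    rw [map_mul, map_add, map_mul, hP', hQ', map_one, h]
  have r2 : beta (nord g1) = nord g1 := by
    apply hW; rw [mapW_beta, hP', hP]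
  have r3 : beta (nord g2) = - nord g2 := by
    apply hW; rw [mapW_beta, mapW_neg, hQ', hQ]
  let σ : R →+* ZMod (p ^ 2) := (PadicInt.toZModPow 2).comp θ
  have d1 : g1.totalDegree ≤ D := by
    rw [tdeg_le_iff]
    intro u hu
    have := (tdeg_le_iff (sym P) _).1 le_rfl u (by
      rw [← hg1, coeff_map]; exact fun h0 => hu (hinj (by rw [h0, map_zero])))
    omega
  have d2 : g2.totalDegree ≤ D := by
    rw [tdeg_le_iff]
    intro u hu
    have := (tdeg_le_iff (sym Q) _).1 le_rfl u (by
      rw [← hg2, coeff_map]; exact fun h0 => hu (hinj (by rw [h0, map_zero])))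
    omega
  have main := modp_deg p (hp.odd_of_ne_two (by omega)) D (by omega) (mapW σ (nord g1)) (mapW σ (nord g2))
    (by rw [← map_mul, r1, map_add, map_mul, map_one]) (by rw [← mapW_beta, r2])
    (by rw [← mapW_beta, r3, mapW_neg])
    (by rw [sym_mapW, sym_nord]; exact tdeg_map_le _ _ _ d1)
    (by rw [sym_mapW, sym_nord]; exact tdeg_map_le _ _ _ d2)
  rw [sym_mapW, sym_mapW, sym_nord, tdeg_le_iff] at main
  rw [← hdeg]
  apply main
  rw [coeff_map, coeff_map]
  have hu : c * coeff e g2 = 1 := by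
    apply hinj
    rw [map_mul, hc, ← coeff_map, hg2, map_one, inv_mul_cancel₀ he]
  intro h0
  have := congrArg (redp p) (congrArg σ hu)
  rw [map_mul, map_mul, h0, mul_zero, map_one, map_one] at this
  exact zero_ne_one this

theorem generate_of {K A : Type} [Field K] [Ring A] [Algebra K A] (S : Subalgebra K A) {x y P Q r : A} {b : K}
    (hb : b ≠ 0) (hQ : Q = b • y) (hr : y ∈ S → r ∈ S) (hP : P = b⁻¹ • x + r) (h1 : P ∈ S) (h2 : Q ∈ S) :
    x ∈ S ∧ y ∈ S := by
  have hy : y ∈ S := by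
    have : y = b⁻¹ • Q := by rw [hQ, smul_smul, inv_mul_cancel₀ hb, one_smul]
    rw [this]
    exact S.smul_mem h2 _
  refine ⟨?_, hy⟩
  have : x = b • (P - r) := by rw [hP, add_sub_cancel_right, smul_smul, mul_inv_cancel₀ hb, one_smul]
  rw [this]
  exact S.smul_mem (S.sub_mem h1 (hr hy)) _

theorem lin_aux {K A : Type} [Field K] [CharZero K] [Ring A] [Algebra K A] {u v : A} (h : u - v = -(u + v)) : u = 0 := by
  have : (2 : K) • u = 0 := by
    rw [two_smul]
    calc u + u = (u - v) + (u + v) := by abel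
      _ = 0 := by rw [h]; abel
  exact (smul_eq_zero.1 this).resolve_left two_ne_zero

theorem core {K : Type} [Field K] [CharZero K] (P Q : Weyl K) (h : Q * P = P * Q + 1)
    (hP : beta P = P) (hQ : beta Q = -Q) (S : Subalgebra K (Weyl K)) (h1 : P ∈ S) (h2 : Q ∈ S) :
    Wx K ∈ S ∧ Wy K ∈ S := by
  have hd := core_deg P Q h hP hQ
  rw [tdeg_le_iff] at hd
  set a := coeff (Finsupp.single 0 1) (sym Q) with ha
  set b := coeff (Finsupp.single 1 1) (sym Q) with hb
  set c := coeff 0 (sym Q) with hc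
  have hg : sym Q = C c + (a • X 0 + b • X 1) := by
    ext e
    by_cases h0 : e = 0
    · subst h0; simp [coeff_X, hc]
    by_cases h0 : e = Finsupp.single 0 1
    · subst h0; simp [coeff_X, ha, Finsupp.single_left_inj, coeff_C]; exact fun h3 => absurd h3.symm ‹_›
    by_cases h0 : e = Finsupp.single 1 1
    · subst h0; simp [coeff_X, hb, Finsupp.single_left_inj, coeff_C]; exact fun h3 => absurd h3.symm ‹¬ Finsupp.single (1 : Fin 2) 1 = 0›
    have : coeff e (sym Q) = 0 := by
      by_contra h3
      have := hd e h3
      have h4 : e 0 + e 1 ≠ 0 := fun h5 => by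
        apply ‹¬ e = 0›
        ext i; fin_cases i <;> simp <;> omega
      have h5 : (e 0 = 1 ∧ e 1 = 0) ∨ (e 0 = 0 ∧ e 1 = 1) := by omega
      rcases h5 with ⟨h5, h6⟩ | ⟨h5, h6⟩
      · apply ‹¬ e = Finsupp.single 0 1›
        ext i; fin_cases i <;> simp [h5, h6]
      · apply ‹¬ e = Finsupp.single 1 1›
        ext i; fin_cases i <;> simp [h5, h6]
    rw [this]
    simp [coeff_X, coeff_C, Ne.symm ‹¬ e = 0›, Ne.symm ‹¬ e = Finsupp.single 1 1›, Ne.symm ‹¬ e = Finsupp.single 0 1›]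
  have hQe : Q = (c • 1 + a • Wx K) + b • Wy K := by
    apply sym_inj
    have e1 : sym (Wx K) = X 0 := by rw [sym_def, wAct_x, mul_one]
    have e2 : sym (Wy K) = X 1 := by simpa using sym_ypow (S := K) 1
    rw [map_add, map_add, map_smul, map_smul, map_smul, sym_one, e1, e2, hg, add_assoc, smul_eq_C_mul 1 c, mul_one]
  have hz : c • 1 + a • Wx K = 0 := by
    apply lin_aux (K := K) (v := b • Wy K)
    rw [← hQe, ← hQ, hQe, beta_add, beta_add, beta_smul, beta_smul, beta_smul, beta_one, beta_x, beta_y, smul_neg,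
      sub_eq_add_neg]
  rw [hz, zero_add] at hQe
  have hb0 : b ≠ 0 := by
    intro h0
    rw [hQe, h0, zero_smul, zero_mul, mul_zero, zero_add] at h
    exact weyl_one_ne h.symm
  have hder : pderiv 0 (sym P) = C b⁻¹ := by
    rw [← comm_y]
    have h3 : b • (Wy K * P - P * Wy K) = 1 := by
      rw [smul_sub, ← smul_mul_assoc, ← mul_smul_comm, ← hQe, h, add_sub_cancel_left]
    have h4 : Wy K * P - P * Wy K = b⁻¹ • 1 := by
      rw [← h3, smul_smul, inv_mul_cancel₀ hb0, one_smul]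
    rw [h4, map_smul, sym_one, smul_eq_C_mul, mul_one]
  refine generate_of S hb0 hQe (r := nord (sym P - b⁻¹ • X 0)) ?_ ?_ h1 h2
  · intro hy
    rw [← support_sum_monomial_coeff (sym P - b⁻¹ • X 0), map_sum]
    refine sum_mem ?_
    intro e he
    rw [nord_monomial]
    have h0 : e 0 = 0 := by
      by_contra hne
      rw [mem_support_iff] at he
      apply he
      have h3 : (e 0 : K) * coeff e (sym P - b⁻¹ • X 0) = 0 := by
        rw [← coeff_euler, map_sub, hder]
        simp [smul_eq_C_mul, Derivation.leibniz]
      exact (mul_eq_zero.1 h3).resolve_left (by exact_mod_cast hne)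
    rw [h0, pow_zero, one_mul]
    exact S.smul_mem (S.pow_mem hy _) _
  · apply sym_inj
    have e1 : sym (Wx K) = X 0 := by rw [sym_def, wAct_x, mul_one]
    rw [map_add, sym_nord, map_smul, e1, add_sub_cancel]


theorem coeff_pd {S : Type} [CommRing S] (i : Fin 2) (g : MvPolynomial (Fin 2) S) (e : Fin 2 →₀ ℕ) :
    coeff e (pderiv i g) = ((e i + 1 : ℕ) : S) * coeff (e + Finsupp.single i 1) g := by
  have h := coeff_euler g i (Finsupp.single i 1 + e)
  rw [coeff_X_mul] at h
  rw [h, add_comm e]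
  simp [add_comm]

theorem pd_step {K : Type} [Field K] [CharZero K] (g : MvPolynomial (Fin 2) K) (i : Fin 2) (e : Fin 2 →₀ ℕ)
    (he : coeff e g ≠ 0) (hi : e i ≠ 0) :
    pderiv i g ≠ 0 ∧ (pderiv i g).totalDegree < g.totalDegree := by
  have hle : Finsupp.single i 1 ≤ e := by
    rw [Finsupp.single_le_iff]; omega
  constructor
  · intro h0
    have h1 := coeff_pd i g (e - Finsupp.single i 1)
    rw [h0, coeff_zero, tsub_add_cancel_of_le hle] at h1
    rcases mul_eq_zero.1 h1.symm with h2 | h2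
    · exact Nat.cast_ne_zero.2 (Nat.succ_ne_zero _) h2
    · exact he h2
  · have hall := (tdeg_le_iff g _).1 le_rfl
    have hpos : 0 < g.totalDegree := by
      have := hall e he
      fin_cases i <;> simp at hi <;> omega
    suffices (pderiv i g).totalDegree ≤ g.totalDegree - 1 by omega
    rw [tdeg_le_iff]
    intro u hu
    rw [coeff_pd] at hu
    have := hall _ (right_ne_zero_of_mul hu)
    fin_cases i <;> simp at this <;> omega

theorem hom_inj {K A : Type} [Field K] [CharZero K] [Ring A] [Nontrivial A] [Algebra K A] (F : Weyl K →ₐ[K] A) :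
    Function.Injective F := by
  have key : ∀ n (a : Weyl K), (sym a).totalDegree = n → F a = 0 → a = 0 := by
    intro n
    induction n using Nat.strong_induction_on with
    | _ n ih =>
      intro a ha hF
      by_contra hne
      have hs : sym a ≠ 0 := fun h0 => hne (sym_inj (by rw [h0, map_zero]))
      by_cases hall : ∀ e, coeff e (sym a) ≠ 0 → e = 0
      · have hc : a = coeff 0 (sym a) • 1 := by
          apply sym_inj
          rw [map_smul, sym_one]
          ext e
          by_cases h0 : e = 0
          · subst h0; simp
          · have : coeff e (sym a) = 0 := by by_contra h1; exact h0 (hall e h1)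
            rw [this, coeff_smul, coeff_one, if_neg (Ne.symm h0), smul_zero]
        rw [hc, map_smul, map_one] at hF
        have h3 : coeff 0 (sym a) = 0 := (smul_eq_zero.1 hF).resolve_right one_ne_zero
        rw [h3, zero_smul] at hc
        exact hne hc
      · push Not at hall
        obtain ⟨e, he, he0⟩ := hall
        by_cases h0 : e 0 = 0
        · have h1 : e 1 ≠ 0 := by
            intro h1
            apply he0
            ext i; fin_cases i <;> simp [h0, h1]
          obtain ⟨h2, h3⟩ := pd_step (sym a) 1 e he h1
          rw [← comm_x] at h2 h3
          rw [ha] at h3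
          apply h2
          rw [ih _ h3 _ rfl (by rw [map_sub, map_mul, map_mul, hF, zero_mul, mul_zero, sub_zero]), map_zero]
        · obtain ⟨h2, h3⟩ := pd_step (sym a) 0 e he h0
          rw [← comm_y] at h2 h3
          rw [ha] at h3
          apply h2
          rw [ih _ h3 _ rfl (by rw [map_sub, map_mul, map_mul, hF, zero_mul, mul_zero, sub_zero]), map_zero]
  rw [injective_iff_map_eq_zero]
  exact fun a h => key _ a rfl h

def toHom {K A : Type} [CommRing K] [Ring A] [Algebra K A] (f : A → A) (hf : IsAlgEndo K f) : A →ₐ[K] A :=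
  AlgHom.ofLinearMap ⟨⟨f, hf.1⟩, hf.2.1⟩ hf.2.2.2 hf.2.2.1

theorem toHom_apply {K A : Type} [CommRing K] [Ring A] [Algebra K A] (f : A → A) (hf : IsAlgEndo K f) (a : A) :
    toHom f hf a = f a := rfl

theorem surj_of_beta {K : Type} [Field K] [CharZero K] (f : Weyl K → Weyl K) (hf : IsAlgEndo K f)
    (hb : ∀ a, f (beta a) = beta (f a)) : Function.Surjective f := by
  have hc := core (toHom f hf (Wx K)) (toHom f hf (Wy K))
    (by rw [← map_mul, Wrel, map_add, map_mul, map_one])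
    (by rw [toHom_apply, ← hb, beta_x])
    (by rw [toHom_apply, ← hb, beta_y, ← toHom_apply f hf, ← toHom_apply f hf]; exact map_neg _ _)
    (toHom f hf).range ⟨_, rfl⟩ ⟨_, rfl⟩
  have : ∀ a, a ∈ (toHom f hf).range := by
    intro a
    induction a using W_induction with
    | h1 => exact one_mem _
    | hs s a h => exact Subalgebra.smul_mem _ h _
    | hx a h => exact mul_mem hc.1 h
    | hy a h => exact mul_mem hc.2 h
    | ha a b h h' => exact add_mem h h'
  intro a
  obtain ⟨b, hb⟩ := this a
  exact ⟨b, hb⟩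

def HA (K : Type) {A : Type} [CommSemiring K] [Semiring A] [Algebra K A] (g : A → A) : Prop :=
  IsAlgEndo K g ∨ IsAntiEndo K g

theorem HA_comp {K A : Type} [CommSemiring K] [Semiring A] [Algebra K A] {g h : A → A} (hg : HA K g) (hh : HA K h) :
    HA K (g ∘ h) := by
  rcases hg with ⟨g1, g2, g3, g4⟩ | ⟨g1, g2, g3, g4⟩ <;> rcases hh with ⟨h1, h2, h3, h4⟩ | ⟨h1, h2, h3, h4⟩
  · left; simp [IsAlgEndo, *]
  · right; simp [IsAntiEndo, *]
  · right; simp [IsAntiEndo, *]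
  · left; simp [IsAlgEndo, *]

theorem HA_inv {K A : Type} [CommSemiring K] [Semiring A] [Algebra K A] {g h : A → A} (hg : HA K g)
    (hl : ∀ a, h (g a) = a) (hr : ∀ a, g (h a) = a) : HA K h := by
  have hi : Function.Injective g := fun a b hab => by rw [← hl a, ← hl b, hab]
  rcases hg with ⟨g1, g2, g3, g4⟩ | ⟨g1, g2, g3, g4⟩
  · left
    refine ⟨fun a b => hi ?_, fun c a => hi ?_, fun a b => hi ?_, hi ?_⟩ <;> simp [*]
  · right
    refine ⟨fun a b => hi ?_, fun c a => hi ?_, fun a b => hi ?_, hi ?_⟩ <;> simp [*]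

theorem beta_anti {K : Type} [Field K] : IsAntiEndo K (beta (S := K)) :=
  ⟨beta_add, beta_smul, beta_mul, beta_one⟩

theorem beta_inv {K : Type} [Field K] : IsInvolutionOn K (beta (S := K)) :=
  ⟨⟨beta_anti, (Function.Involutive.bijective (f := beta (S := K)) beta_beta)⟩, funext beta_beta⟩

theorem surj_of_beta' {K : Type} [Field K] [CharZero K] (f : Weyl K → Weyl K) (hf : HA K f)
    (hb : ∀ a, f (beta a) = beta (f a)) : Function.Surjective f := by
  rcases hf with hf | hf
  · exact surj_of_beta f hf hb
  · have h1 : IsAlgEndo K (f ∘ beta) := by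
      obtain ⟨g1, g2, g3, g4⟩ := hf
      refine ⟨?_, ?_, ?_, ?_⟩ <;> simp [beta_add, beta_smul, beta_mul, beta_one, *]
    have := surj_of_beta (f ∘ beta) h1 (fun a => by simp only [Function.comp]; rw [hb])
    exact this.of_comp

theorem conj_data {K : Type} [Field K] {α γ : Weyl K → Weyl K} (h : ConjToAlpha K α γ) :
    ∃ g h : Weyl K → Weyl K, HA K g ∧ HA K h ∧ (∀ a, h (g a) = a) ∧ (∀ a, g (h a) = a) ∧ ∀ a, g (γ a) = α (g a) := by
  obtain ⟨g, hg, hγ⟩ := h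
  have hbij : Function.Bijective g := by
    rcases hg with hg | hg <;> exact hg.2
  have hHA : HA K g := by
    rcases hg with hg | hg
    · exact Or.inl hg.1
    · exact Or.inr hg.1
  have hl : ∀ a, Function.invFun g (g a) = a := Function.leftInverse_invFun hbij.1
  have hr : ∀ a, g (Function.invFun g a) = a := Function.rightInverse_invFun hbij.2
  refine ⟨g, Function.invFun g, hHA, HA_inv hHA hl hr, hl, hr, ?_⟩
  intro a
  rw [hγ]
  exact hr _

theorem stmt_12 {K : Type} [Field K] [CharZero K]
    (α : Weyl K → Weyl K) (hα : IsExchange K α)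
    (hB : ∀ γ : Weyl K → Weyl K, IsInvolutionOn K γ → ConjToAlpha K α γ)
    (f : Weyl K → Weyl K) (hf : IsAlgEndo K f)
    (T : Subalgebra K (Weyl K)) (hT : T = Algebra.adjoin K {f (Wx K), f (Wy K)})
    (E : Weyl K → Weyl K) (hE : IsInvolutionOn K E)
    (hP : E (f (Wx K)) ∈ T) (hQ : E (f (Wy K)) ∈ T) :
    IsAlgAuto K f := by
  haveI : Nontrivial (Weyl K) := ⟨1, 0, weyl_one_ne⟩
  have hinj : Function.Injective f := hom_inj (toHom f hf)
  have hTle : T ≤ (toHom f hf).range := by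
    rw [hT, Algebra.adjoin_le_iff]
    intro x hx
    rcases hx with rfl | hx
    · exact ⟨_, rfl⟩
    · rw [Set.mem_singleton_iff.1 hx]; exact ⟨_, rfl⟩
  obtain ⟨⟨⟨E1, E2, E3, E4⟩, -⟩, E5⟩ := hE
  have E5' : ∀ a, E (E a) = a := fun a => congrFun E5 a
  obtain ⟨f1, f2, f3, f4⟩ := id hf
  have hmem : ∀ a, E (f a) ∈ (toHom f hf).range := by
    intro a
    induction a using W_induction with
    | h1 => rw [f4, E4]; exact one_mem _
    | hs s a h => rw [f2, E2]; exact Subalgebra.smul_mem _ h _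
    | hx a h => rw [f3, E3]; exact mul_mem h (hTle hP)
    | hy a h => rw [f3, E3]; exact mul_mem h (hTle hQ)
    | ha a b h h' => rw [f1, E1]; exact add_mem h h'
  have hex : ∀ a, ∃ b, f b = E (f a) := hmem
  choose γ hγ using hex
  have γγ : ∀ a, γ (γ a) = a := fun a => hinj (by rw [hγ, hγ, E5'])
  have hγinv : IsInvolutionOn K γ := by
    refine ⟨⟨⟨fun a b => hinj ?_, fun c a => hinj ?_, fun a b => hinj ?_, hinj ?_⟩,
      Function.Involutive.bijective γγ⟩, funext γγ⟩
    · rw [hγ, f1, f1, E1, hγ, hγ]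
    · rw [hγ, f2, f2, E2, hγ]
    · rw [hγ, f3, f3, E3, hγ, hγ]
    · rw [hγ, f4, E4]
  obtain ⟨g1, k1, a1, b1, l1, r1, c1⟩ := conj_data (hB γ hγinv)
  obtain ⟨g2, k2, a2, b2, l2, r2, c2⟩ := conj_data (hB E ⟨⟨⟨E1, E2, E3, E4⟩, Function.Involutive.bijective E5'⟩, E5⟩)
  obtain ⟨g3, k3, a3, b3, l3, r3, c3⟩ := conj_data (hB beta beta_inv)
  have hs := surj_of_beta' ((k3 ∘ g2) ∘ f ∘ (k1 ∘ g3))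
    (HA_comp (HA_comp b3 a2) (HA_comp (Or.inl hf) (HA_comp b1 a3))) (by
      intro a
      simp only [Function.comp]
      have e1 : k1 (g3 (beta a)) = γ (k1 (g3 a)) := by
        rw [c3, ← l1 (γ _), c1, r1]
      rw [e1, hγ, c2, ← l3 (beta _), c3, r3])
  refine ⟨hf, hinj, ?_⟩
  intro y
  obtain ⟨x, hx⟩ := hs (k3 (g2 y))
  refine ⟨k1 (g3 x), ?_⟩
  have h1 := congrArg (fun z => k2 (g3 z)) hx
  simpa [Function.comp, r3, l2] using h1
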